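/- arXiv:0903.1780 — 3 statements merged into one kernel-verified Lean document; each statement's English description precedes it below -/
import Mathlib

section
/- Let -1/2 < l < 1/2 and let χ ∈ C_0^∞(ℝ) with χ ≡ 1 on [-1/2,1/2]. Set m_l(ξ₁,ξ₂) = ∫_ℝ e^{-i(ξ₁t+ξ₂t³)} χ(t) |t|^{-(l+1/2)} dt. Then ξ₂^{(1-2l)/6} · m_l(0,ξ₂) converges, as ξ₂ → +∞, to (1/3) · lim_{R→∞} ∫_{-R}^{R} e^{-iu}|u|^{-(2l+5)/6} du, which is nonzero. Consequently: (a) for no exponent r < (2l-1)/6 does there exist a constant C with |m_l(ξ)| ≤ C(1+|ξ|)^r for all ξ ∈ ℝ²; and (b) the Fourier multiplier operator 𝒥_{l+1/2} with multiplier m_l is not bounded from H^s(ℝ²) to H^{s-r}(ℝ²) for any s ∈ ℝ and any r < (2l-1)/6. Hence the Sobolev exponent r = (2l-1)/6 for 𝒥_{l+1/2} is sharp. -/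
open MeasureTheory Filter Real
open scoped ENNReal NNReal

theorem hasDerivAt_cosPrimitive (a : ℝ) {u : ℝ} (hu : 0 < u) :
    HasDerivAt (fun u : ℝ => sin u * u ^ (-a) + a * ((1 - cos u) * u ^ (-a - 1)))
      (cos u * u ^ (-a) - a * (a + 1) * ((1 - cos u) * u ^ (-a - 2))) u := by
  have h1 := hasDerivAt_rpow_const (x := u) (p := -a) (Or.inl hu.ne')
  have h2 := hasDerivAt_rpow_const (x := u) (p := -a - 1) (Or.inl hu.ne')
  have h3 := ((hasDerivAt_sin u).mul h1).add
    ((((hasDerivAt_cos u).const_sub 1).mul h2).const_mul a)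
  refine h3.congr_deriv ?_
  rw [show -a - 1 - 1 = -a - 2 by ring]
  ring

theorem one_sub_cos_mul_rpow_le (p : ℝ) {u : ℝ} (hu : 0 < u) :
    (1 - cos u) * u ^ p ≤ u ^ (p + 2) := by
  rw [rpow_add hu, rpow_two, mul_comm (u ^ p)]
  have := one_sub_sq_div_two_le_cos (x := u)
  gcongr
  nlinarith [sq_nonneg u]

theorem continuousOn_cosPrimitive {a : ℝ} (ha1 : a < 1) :
    ContinuousOn (fun u : ℝ => sin u * u ^ (-a) + a * ((1 - cos u) * u ^ (-a - 1)))
      (Set.Ici 0) := by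
  intro u hu
  rcases (Set.mem_Ici.1 hu).eq_or_lt with rfl | hu
  · have hlim : Tendsto (fun u : ℝ => u ^ (1 - a)) (nhdsWithin 0 (Set.Ici 0)) (nhds 0) := by
      have := (continuousAt_rpow_const 0 (1 - a) (Or.inr (by linarith))).tendsto
      rw [zero_rpow (by linarith)] at this
      exact this.mono_left nhdsWithin_le_nhds
    have key : ∀ f : ℝ → ℝ, f 0 = 0 → (∀ u, 0 < u → |f u| ≤ u ^ (1 - a)) →
        Tendsto f (nhdsWithin 0 (Set.Ici 0)) (nhds 0) := by
      intro f h0 hf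
      refine squeeze_zero_norm' ?_ hlim
      filter_upwards [self_mem_nhdsWithin] with u hu
      rcases (Set.mem_Ici.1 hu).eq_or_lt with rfl | hu
      · rw [h0, norm_zero]; positivity
      · exact hf u hu
    have h1 := key (fun u => sin u * u ^ (-a)) (by simp) (fun u hu => by
      rw [abs_mul, abs_of_pos (rpow_pos_of_pos hu _), sub_eq_add_neg, rpow_add hu, rpow_one]
      gcongr
      exact (abs_sin_le_abs).trans_eq (abs_of_pos hu))
    have h2 := key (fun u => (1 - cos u) * u ^ (-a - 1)) (by simp) (fun u hu => by
      rw [abs_of_nonneg (mul_nonneg (by linarith [cos_le_one u]) (by positivity))]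
      exact (one_sub_cos_mul_rpow_le _ hu).trans_eq (by ring_nf))
    unfold ContinuousWithinAt
    simpa using h1.add (h2.const_mul a)
  · exact (hasDerivAt_cosPrimitive a hu).continuousAt.continuousWithinAt

theorem integrableOn_one_sub_cos_mul_rpow {a : ℝ} (ha0 : 0 < a) (ha1 : a < 1) :
    IntegrableOn (fun u : ℝ => (1 - cos u) * u ^ (-a - 2)) (Set.Ioi 0) := by
  have hmeas : Measurable (fun u : ℝ => (1 - cos u) * u ^ (-a - 2)) := by fun_prop
  rw [← Set.Ioc_union_Ioi_eq_Ioi zero_le_one]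
  refine IntegrableOn.union ?_ ?_
  · have h := (intervalIntegral.intervalIntegrable_rpow' (a := 0) (b := 1) (r := -a)
      (by linarith)).1
    refine Integrable.mono' h hmeas.aestronglyMeasurable ?_
    filter_upwards [ae_restrict_mem measurableSet_Ioc] with u hu
    rw [norm_of_nonneg (mul_nonneg (by linarith [cos_le_one u]) (rpow_nonneg hu.1.le _))]
    exact (one_sub_cos_mul_rpow_le _ hu.1).trans_eq (by ring_nf)
  · have h := (integrableOn_Ioi_rpow_of_lt (a := -a - 2) (by linarith) one_pos).const_mul 2
    refine Integrable.mono' h hmeas.aestronglyMeasurable ?_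
    filter_upwards [ae_restrict_mem measurableSet_Ioi] with u hu
    have hu0 : (0 : ℝ) ≤ u := zero_le_one.trans (Set.mem_Ioi.1 hu).le
    rw [norm_of_nonneg (mul_nonneg (by linarith [cos_le_one u]) (rpow_nonneg hu0 _))]
    gcongr
    linarith [neg_one_le_cos u]

theorem setIntegral_one_sub_cos_mul_rpow_pos {a : ℝ} (ha0 : 0 < a) (ha1 : a < 1) :
    0 < ∫ u in Set.Ioi (0 : ℝ), (1 - cos u) * u ^ (-a - 2) := by
  rw [setIntegral_pos_iff_support_of_nonneg_ae ?_ (integrableOn_one_sub_cos_mul_rpow ha0 ha1)]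
  · refine lt_of_lt_of_le (b := volume (Set.Ioo (0 : ℝ) 1)) (by simp) (measure_mono ?_)
    intro u hu
    have hc : cos u < 1 := by
      simpa using cos_lt_cos_of_nonneg_of_le_pi le_rfl (by linarith [hu.2, pi_gt_three]) hu.1
    exact ⟨mul_ne_zero (by linarith) (rpow_pos_of_pos hu.1 _).ne', hu.1⟩
  · filter_upwards [ae_restrict_mem measurableSet_Ioi] with u hu
    exact mul_nonneg (by linarith [cos_le_one u]) (rpow_nonneg (Set.mem_Ioi.1 hu).le _)

theorem intervalIntegrable_cos_mul_rpow {a : ℝ} (ha1 : a < 1) (R S : ℝ) :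
    IntervalIntegrable (fun u : ℝ => cos u * u ^ (-a)) volume R S :=
  (intervalIntegral.intervalIntegrable_rpow' (by linarith)).continuousOn_mul
    continuous_cos.continuousOn

/-- Two integrations by parts turn the conditionally convergent cosine integral into an
absolutely convergent one with a positive integrand. -/
theorem integral_cos_mul_rpow {a : ℝ} (ha0 : 0 < a) (ha1 : a < 1) {R : ℝ} (hR : 0 ≤ R) :
    ∫ u in (0 : ℝ)..R, cos u * u ^ (-a) =
      sin R * R ^ (-a) + a * ((1 - cos R) * R ^ (-a - 1)) +
        a * (a + 1) * ∫ u in (0 : ℝ)..R, (1 - cos u) * u ^ (-a - 2) := by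
  have hk : IntervalIntegrable (fun u : ℝ => (1 - cos u) * u ^ (-a - 2)) volume 0 R := by
    rw [intervalIntegrable_iff_integrableOn_Ioc_of_le hR]
    exact (integrableOn_one_sub_cos_mul_rpow ha0 ha1).mono_set Set.Ioc_subset_Ioi_self
  have hc := intervalIntegrable_cos_mul_rpow ha1 0 R
  have h := intervalIntegral.integral_eq_sub_of_hasDerivAt_of_le hR
    ((continuousOn_cosPrimitive ha1).mono Set.Icc_subset_Ici_self)
    (fun u hu => hasDerivAt_cosPrimitive a hu.1) (hc.sub (hk.const_mul _))
  rw [intervalIntegral.integral_sub hc (hk.const_mul _),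
    intervalIntegral.integral_const_mul] at h
  simp only [sin_zero, cos_zero, sub_self, zero_mul, mul_zero, add_zero, sub_zero] at h
  linarith

theorem exists_pos_tendsto_integral_cos_mul_rpow {a : ℝ} (ha0 : 0 < a) (ha1 : a < 1) :
    ∃ c : ℝ, 0 < c ∧
      Tendsto (fun R : ℝ => ∫ u in (0 : ℝ)..R, cos u * u ^ (-a)) atTop (nhds c) := by
  refine ⟨a * (a + 1) * ∫ u in Set.Ioi (0 : ℝ), (1 - cos u) * u ^ (-a - 2),
    mul_pos (by positivity) (setIntegral_one_sub_cos_mul_rpow_pos ha0 ha1), ?_⟩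
  have h1 : Tendsto (fun R : ℝ => sin R * R ^ (-a)) atTop (nhds 0) := by
    refine squeeze_zero_norm' ?_ (tendsto_rpow_neg_atTop ha0)
    filter_upwards [eventually_ge_atTop 0] with R hR
    rw [norm_mul, norm_of_nonneg (rpow_nonneg hR _)]
    exact mul_le_of_le_one_left (rpow_nonneg hR _) (abs_sin_le_one R)
  have h2 : Tendsto (fun R : ℝ => (1 - cos R) * R ^ (-a - 1)) atTop (nhds 0) := by
    have h := (tendsto_rpow_neg_atTop (y := a + 1) (by linarith)).const_mul 2
    rw [mul_zero] at h
    refine squeeze_zero_norm' ?_ h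
    filter_upwards [eventually_ge_atTop 0] with R hR
    rw [norm_mul, norm_of_nonneg (rpow_nonneg hR _), neg_add', norm_of_nonneg (by linarith [cos_le_one R])]
    gcongr
    linarith [neg_one_le_cos R]
  have h3 := intervalIntegral_tendsto_integral_Ioi 0
    (integrableOn_one_sub_cos_mul_rpow ha0 ha1) tendsto_id
  have h := (h1.add (h2.const_mul a)).add (h3.const_mul (a * (a + 1)))
  simp only [mul_zero, add_zero, zero_add] at h
  refine h.congr' ?_
  filter_upwards [eventually_ge_atTop 0] with R hR
  exact (integral_cos_mul_rpow ha0 ha1 hR).symm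

theorem integral_cos_cube_mul_rpow {b : ℝ} (hb1 : b < 1) {ξ A : ℝ} (hξ : 0 < ξ)
    (hA : 0 ≤ A) :
    ξ ^ ((1 - b) / 3) * ∫ t in (0 : ℝ)..A, cos (ξ * t ^ 3) * t ^ (-b) =
      (∫ u in (0 : ℝ)..(ξ * A ^ 3), cos u * u ^ (-((b + 2) / 3))) / 3 := by
  have hint : ∀ R S, IntervalIntegrable (fun u : ℝ => cos u * u ^ (-((b + 2) / 3))) volume R S :=
    intervalIntegrable_cos_mul_rpow (by linarith)
  have hb : IntervalIntegrable (fun t : ℝ => cos (ξ * t ^ 3) * t ^ (-b)) volume 0 A :=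
    (intervalIntegral.intervalIntegrable_rpow' (by linarith)).continuousOn_mul
      (by fun_prop)
  have h := intervalIntegral.integral_eq_sub_of_hasDerivAt_of_le
    (f := fun t => ∫ u in (0 : ℝ)..(ξ * t ^ 3), cos u * u ^ (-((b + 2) / 3)))
    (f' := fun t => 3 * ξ ^ ((1 - b) / 3) * (cos (ξ * t ^ 3) * t ^ (-b))) hA ?_ ?_
    (hb.const_mul _)
  · simp only [intervalIntegral.integral_const_mul] at h
    simp only [ne_eq, OfNat.ofNat_ne_zero, not_false_eq_true, zero_pow, mul_zero,
      intervalIntegral.integral_same, sub_zero] at h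
    linarith
  · exact ((intervalIntegral.continuous_primitive hint 0).comp
      (by fun_prop : Continuous fun t : ℝ => ξ * t ^ 3)).continuousOn
  · intro t ht
    have ht0 : 0 < t := ht.1
    have hu : 0 < ξ * t ^ 3 := by positivity
    have hd := intervalIntegral.integral_hasDerivAt_right (hint 0 (ξ * t ^ 3))
      (by fun_prop : Measurable fun u : ℝ => cos u * u ^ (-((b + 2) / 3))).stronglyMeasurable.stronglyMeasurableAtFilter
      (continuous_cos.continuousAt.mul (continuousAt_rpow_const _ _ (Or.inl hu.ne')))
    refine (hd.comp t ((hasDerivAt_pow 3 t).const_mul ξ)).congr_deriv ?_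
    have e1 : ξ ^ ((1 - b) / 3) = ξ ^ (-((b + 2) / 3)) * ξ := by
      rw [← rpow_add_one hξ.ne']; ring_nf
    have e2 : t ^ (-b) = (t ^ 3) ^ (-((b + 2) / 3)) * t ^ 2 := by
      rw [← rpow_natCast t 3, ← rpow_mul ht0.le, ← rpow_natCast t 2, ← rpow_add ht0]
      congr 1; push_cast; ring
    rw [e1, e2, mul_rpow hξ.le (by positivity)]
    push_cast
    ring

theorem norm_integral_exp_cube_mul_rpow_le {f : ℝ → ℝ} (hf : ContDiff ℝ 1 f) (b : ℝ) {A B : ℝ}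
    (hA : 0 < A) (hAB : A ≤ B) :
    ∃ K : ℝ, ∀ ξ : ℝ, ξ ≠ 0 →
      ‖∫ t in A..B, Complex.exp (-(Complex.I * ((ξ : ℂ) * (t : ℂ) ^ 3))) * (f t : ℂ) *
        ((t ^ (-b) : ℝ) : ℂ)‖ ≤ K / |ξ| := by
  set ψ : ℝ → ℝ := fun t => f t * t ^ (-b - 2) with hψ
  set ψ' : ℝ → ℝ := fun t => deriv f t * t ^ (-b - 2) + f t * ((-b - 2) * t ^ (-b - 2 - 1))
    with hψ'
  have hpos : ∀ t ∈ Set.uIcc A B, 0 < t := fun t ht => by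
    rw [Set.uIcc_of_le hAB] at ht
    exact hA.trans_le ht.1
  have hderiv : ∀ t ∈ Set.uIcc A B, HasDerivAt ψ (ψ' t) t := fun t ht =>
    ((hf.differentiable one_ne_zero t).hasDerivAt).mul
      (hasDerivAt_rpow_const (Or.inl (hpos t ht).ne'))
  have hcont : ContinuousOn ψ' (Set.uIcc A B) := by
    have hr : ∀ p : ℝ, ContinuousOn (fun t : ℝ => t ^ p) (Set.uIcc A B) := fun p t ht =>
      (continuousAt_rpow_const _ _ (Or.inl (hpos t ht).ne')).continuousWithinAt
    have hd := (hf.continuous_deriv le_rfl).continuousOn (s := Set.uIcc A B)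
    exact (hd.mul (hr _)).add (hf.continuous.continuousOn.mul (continuousOn_const.mul (hr _)))
  refine ⟨(|ψ B| + |ψ A| + ∫ t in A..B, |ψ' t|) / 3, fun ξ hξ => ?_⟩
  set e : ℝ → ℂ := fun t => Complex.exp (-(Complex.I * ((ξ : ℂ) * (t : ℂ) ^ 3))) with he
  have hnorm : ∀ t, ‖e t‖ = 1 := fun t => by
    have : e t = Complex.exp (((-(ξ * t ^ 3) : ℝ) : ℂ) * Complex.I) := by
      rw [he]; push_cast; ring_nf
    rw [this, Complex.norm_exp_ofReal_mul_I]
  have hec : Continuous e := by fun_prop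
  have hede : ∀ t, HasDerivAt e (e t * (-(Complex.I * (ξ * (3 * (t : ℂ) ^ 2))))) t := fun t => by
    have h := ((((hasDerivAt_pow 3 (t : ℂ)).const_mul (ξ : ℂ)).const_mul
      Complex.I).neg.cexp).comp_ofReal
    simpa using h
  have hibp := intervalIntegral.integral_mul_deriv_eq_deriv_mul (a := A) (b := B)
    (u := fun t => (ψ t : ℂ)) (u' := fun t => (ψ' t : ℂ)) (v := e)
    (fun t ht => (hderiv t ht).ofReal_comp) (fun t _ => hede t)
    ((Complex.continuous_ofReal.comp_continuousOn hcont).intervalIntegrable)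
    (Continuous.intervalIntegrable (by fun_prop) _ _)
  have hlhs : ∫ t in A..B, (ψ t : ℂ) * (e t * (-(Complex.I * (ξ * (3 * (t : ℂ) ^ 2))))) =
      (-(3 * Complex.I * ξ)) * ∫ t in A..B, e t * (f t : ℂ) * ((t ^ (-b) : ℝ) : ℂ) := by
    rw [← intervalIntegral.integral_const_mul]
    refine intervalIntegral.integral_congr fun t ht => ?_
    have ht0 := hpos t ht
    have : t ^ (-b) = t ^ (-b - 2) * t ^ 2 := by
      rw [← rpow_natCast t 2, ← rpow_add ht0]; congr 1; push_cast; ring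
    simp only [hψ, this]
    push_cast
    ring
  rw [hlhs] at hibp
  have hb : ‖∫ t in A..B, (ψ' t : ℂ) * e t‖ ≤ ∫ t in A..B, |ψ' t| := by
    refine (intervalIntegral.norm_integral_le_integral_norm hAB).trans_eq ?_
    simp only [norm_mul, hnorm, mul_one, Complex.norm_real, norm_eq_abs]
  have hn := congrArg norm hibp
  rw [norm_mul, norm_neg, norm_mul, norm_mul, Complex.norm_I, Complex.norm_real, norm_eq_abs] at hn
  have hle : ‖(ψ B : ℂ) * e B - ψ A * e A - ∫ t in A..B, (ψ' t : ℂ) * e t‖ ≤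
      |ψ B| + |ψ A| + ∫ t in A..B, |ψ' t| := by
    refine (norm_sub_le _ _).trans (add_le_add ((norm_sub_le _ _).trans_eq ?_) hb)
    simp [hnorm]
  rw [← hn] at hle
  rw [le_div_iff₀ (abs_pos.2 hξ)]
  norm_num at hle
  linarith

theorem intervalIntegrable_abs_rpow {p : ℝ} (hp : -1 < p) (R S : ℝ) :
    IntervalIntegrable (fun t : ℝ => |t| ^ p) volume R S := by
  have h0 : ∀ x : ℝ, 0 ≤ x → IntervalIntegrable (fun t : ℝ => |t| ^ p) volume 0 x := by
    intro x hx
    refine (intervalIntegral.intervalIntegrable_rpow' hp).congr ?_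
    intro t ht
    rw [Set.uIoc_of_le hx] at ht
    simp [abs_of_pos ht.1]
  have h : ∀ x : ℝ, IntervalIntegrable (fun t : ℝ => |t| ^ p) volume 0 x := by
    intro x
    rcases le_total 0 x with hx | hx
    · exact h0 x hx
    · rw [IntervalIntegrable.iff_comp_neg]
      simpa using h0 (-x) (by linarith)
  exact (h R).symm.trans (h S)

theorem integral_mul_abs_rpow_eq {p : ℝ} (hp : -1 < p) {g : ℝ → ℂ} (hg : Continuous g) {R : ℝ}
    (hR : 0 ≤ R) :
    ∫ t in (-R)..R, g t * ((|t| ^ p : ℝ) : ℂ) =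
      ∫ t in (0 : ℝ)..R, (g t + g (-t)) * ((t ^ p : ℝ) : ℂ) := by
  have hi : ∀ (k : ℝ → ℂ), Continuous k → ∀ S T : ℝ,
      IntervalIntegrable (fun t => k t * ((|t| ^ p : ℝ) : ℂ)) volume S T := fun k hk S T =>
    have h := intervalIntegrable_abs_rpow hp S T
    IntervalIntegrable.continuousOn_mul (f := fun t => ((|t| ^ p : ℝ) : ℂ))
      ⟨h.1.ofReal, h.2.ofReal⟩ hk.continuousOn
  rw [← intervalIntegral.integral_add_adjacent_intervals (hi g hg (-R) 0) (hi g hg 0 R)]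
  have h := intervalIntegral.integral_comp_neg (a := 0) (b := R)
    (fun t => g t * ((|t| ^ p : ℝ) : ℂ))
  rw [neg_zero] at h
  simp only [abs_neg] at h
  rw [← h, add_comm, ← intervalIntegral.integral_add (hi g hg 0 R)
    (hi (fun t => g (-t)) (by fun_prop) 0 R)]
  refine intervalIntegral.integral_congr fun t ht => ?_
  rw [Set.uIcc_of_le hR] at ht
  simp only [abs_of_nonneg ht.1]
  ring

theorem integral_exp_mul_abs_rpow_eq {p : ℝ} (hp : -1 < p) {R : ℝ} (hR : 0 ≤ R) :
    ∫ u in Set.Icc (-R) R, Complex.exp (-(Complex.I * (u : ℂ))) * ((|u| ^ p : ℝ) : ℂ) =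
      ((2 * ∫ u in (0 : ℝ)..R, cos u * u ^ p : ℝ) : ℂ) := by
  rw [integral_Icc_eq_integral_Ioc, ← intervalIntegral.integral_of_le (by linarith),
    integral_mul_abs_rpow_eq hp (by fun_prop) hR, ← intervalIntegral.integral_const_mul,
    ← intervalIntegral.integral_ofReal]
  refine intervalIntegral.integral_congr fun u _ => ?_
  have h := Complex.two_cos (u : ℂ)
  push_cast
  rw [← mul_assoc, h]
  ring_nf

/-- The multiplier on the vertical axis is a rescaled truncated oscillatory integral, up to
`O(1/ξ)`. -/
theorem exists_norm_integral_sub_le {b : ℝ} (hb1 : b < 1) {χ : ℝ → ℝ} (hχ : ContDiff ℝ 1 χ)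
    (hsupp : HasCompactSupport χ) (hone : ∀ t : ℝ, |t| ≤ 1 / 2 → χ t = 1) :
    ∃ K : ℝ, ∀ ξ : ℝ, 0 < ξ →
      ‖(∫ t : ℝ, Complex.exp (-(Complex.I * ((ξ : ℂ) * (t : ℂ) ^ 3))) * (χ t : ℂ) *
          ((|t| ^ (-b) : ℝ) : ℂ)) -
        ((2 * ∫ t in (0 : ℝ)..(1 / 2), cos (ξ * t ^ 3) * t ^ (-b) : ℝ) : ℂ)‖ ≤ K / ξ := by
  obtain ⟨M, hM, hMχ⟩ : ∃ M : ℝ, 1 / 2 ≤ M ∧ ∀ t, M ≤ |t| → χ t = 0 := by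
    obtain ⟨M, hM⟩ := hsupp.isBounded.subset_closedBall 0
    refine ⟨max (1 / 2) (M + 1), le_max_left _ _, fun t ht => ?_⟩
    refine image_eq_zero_of_notMem_tsupport fun hmem => ?_
    have h1 := hM hmem
    rw [mem_closedBall_zero_iff, norm_eq_abs] at h1
    linarith [le_max_right (1 / 2) (M + 1)]
  obtain ⟨K₁, hK₁⟩ := norm_integral_exp_cube_mul_rpow_le hχ b (A := 1 / 2) (by norm_num) hM
  obtain ⟨K₂, hK₂⟩ := norm_integral_exp_cube_mul_rpow_le (f := fun t => χ (-t))
    (hχ.comp contDiff_neg) b (A := 1 / 2) (by norm_num) hM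
  refine ⟨K₁ + K₂, fun ξ hξ => ?_⟩
  have hχc := hχ.continuous
  have hsub : Function.support (fun t : ℝ => Complex.exp (-(Complex.I * ((ξ : ℂ) * (t : ℂ) ^ 3))) *
      (χ t : ℂ) * ((|t| ^ (-b) : ℝ) : ℂ)) ⊆ Set.Ioc (-M) M := by
    intro t ht
    have hlt : |t| < M := by
      by_contra! h
      exact ht (by simp [hMχ t h])
    exact ⟨(abs_lt.1 hlt).1, (abs_lt.1 hlt).2.le⟩
  have hi : ∀ (k : ℝ → ℂ), Continuous k → ∀ S T : ℝ,
      IntervalIntegrable (fun t => k t * ((t ^ (-b) : ℝ) : ℂ)) volume S T := fun k hk S T =>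
    have h := intervalIntegral.intervalIntegrable_rpow' (a := S) (b := T) (r := -b) (by linarith)
    IntervalIntegrable.continuousOn_mul (f := fun t => ((t ^ (-b) : ℝ) : ℂ))
      ⟨h.1.ofReal, h.2.ofReal⟩ hk.continuousOn
  have hg : Continuous fun t : ℝ =>
      Complex.exp (-(Complex.I * ((ξ : ℂ) * (t : ℂ) ^ 3))) * (χ t : ℂ) := by fun_prop
  have hg' : Continuous fun t : ℝ =>
      Complex.exp (-(Complex.I * (((-ξ : ℝ) : ℂ) * (t : ℂ) ^ 3))) * (χ (-t) : ℂ) := by fun_prop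
  have hfold : (fun t : ℝ => (Complex.exp (-(Complex.I * ((ξ : ℂ) * (t : ℂ) ^ 3))) * (χ t : ℂ) +
      Complex.exp (-(Complex.I * ((ξ : ℂ) * ((-t : ℝ) : ℂ) ^ 3))) * (χ (-t) : ℂ)) *
        ((t ^ (-b) : ℝ) : ℂ)) = fun t : ℝ =>
      Complex.exp (-(Complex.I * ((ξ : ℂ) * (t : ℂ) ^ 3))) * (χ t : ℂ) * ((t ^ (-b) : ℝ) : ℂ) +
      Complex.exp (-(Complex.I * (((-ξ : ℝ) : ℂ) * (t : ℂ) ^ 3))) * (χ (-t) : ℂ) *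
        ((t ^ (-b) : ℝ) : ℂ) := by
    funext t
    push_cast
    ring_nf
  have hnear : ∫ t in (0 : ℝ)..(1 / 2),
      (Complex.exp (-(Complex.I * ((ξ : ℂ) * (t : ℂ) ^ 3))) * (χ t : ℂ) * ((t ^ (-b) : ℝ) : ℂ) +
      Complex.exp (-(Complex.I * (((-ξ : ℝ) : ℂ) * (t : ℂ) ^ 3))) * (χ (-t) : ℂ) *
        ((t ^ (-b) : ℝ) : ℂ)) =
      ((2 * ∫ t in (0 : ℝ)..(1 / 2), cos (ξ * t ^ 3) * t ^ (-b) : ℝ) : ℂ) := by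
    rw [← intervalIntegral.integral_const_mul, ← intervalIntegral.integral_ofReal]
    refine intervalIntegral.integral_congr fun t ht => ?_
    rw [Set.uIcc_of_le (by norm_num)] at ht
    have habs : |t| ≤ 1 / 2 := (abs_of_nonneg ht.1).trans_le ht.2
    have h := Complex.two_cos ((ξ : ℂ) * (t : ℂ) ^ 3)
    simp only [hone t habs, hone (-t) ((abs_neg t).trans_le habs)]
    push_cast
    rw [← mul_assoc 2, h]
    ring_nf
  rw [← intervalIntegral.integral_eq_integral_of_support_subset hsub,
    integral_mul_abs_rpow_eq (by linarith) hg (by linarith), hfold,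
    ← intervalIntegral.integral_add_adjacent_intervals
      ((hi _ hg 0 (1 / 2)).add (hi _ hg' 0 (1 / 2)))
      ((hi _ hg (1 / 2) M).add (hi _ hg' (1 / 2) M)), hnear, add_sub_cancel_left,
    intervalIntegral.integral_add (hi _ hg (1 / 2) M) (hi _ hg' (1 / 2) M), add_div]
  have h1 := hK₁ ξ hξ.ne'
  have h2 := hK₂ (-ξ) (neg_ne_zero.2 hξ.ne')
  rw [abs_neg] at h2
  rw [abs_of_pos hξ] at h1 h2
  exact (norm_add_le _ _).trans (add_le_add h1 h2)

theorem tendsto_rpow_mul_integral_exp_cube {b c : ℝ} (hb0 : 0 < b) (hb1 : b < 1) {χ : ℝ → ℝ}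
    (hχ : ContDiff ℝ 1 χ) (hsupp : HasCompactSupport χ) (hone : ∀ t : ℝ, |t| ≤ 1 / 2 → χ t = 1)
    (hc : Tendsto (fun R : ℝ => ∫ u in (0 : ℝ)..R, cos u * u ^ (-((b + 2) / 3))) atTop (nhds c)) :
    Tendsto (fun ξ : ℝ => ((ξ ^ ((1 - b) / 3) : ℝ) : ℂ) *
      ∫ t : ℝ, Complex.exp (-(Complex.I * ((ξ : ℂ) * (t : ℂ) ^ 3))) * (χ t : ℂ) *
          ((|t| ^ (-b) : ℝ) : ℂ)) atTop (nhds (((2 * c : ℝ) : ℂ) / 3)) := by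
  obtain ⟨K, hK⟩ := exists_norm_integral_sub_le hb1 hχ hsupp hone
  set J : ℝ → ℝ := fun ξ => ∫ t in (0 : ℝ)..(1 / 2), cos (ξ * t ^ 3) * t ^ (-b)
  have hmain : Tendsto (fun ξ : ℝ => ((ξ ^ ((1 - b) / 3) : ℝ) : ℂ) * ((2 * J ξ : ℝ) : ℂ)) atTop
      (nhds (((2 * c : ℝ) : ℂ) / 3)) := by
    have hlim : Tendsto (fun ξ : ℝ => ξ * (1 / 2 : ℝ) ^ 3) atTop atTop :=
      tendsto_id.atTop_mul_const (by norm_num)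
    have h := (Complex.continuous_ofReal.tendsto _).comp (((hc.comp hlim).const_mul 2).div_const 3)
    push_cast at h ⊢
    refine h.congr' ?_
    filter_upwards [eventually_gt_atTop 0] with ξ hξ
    have hs := integral_cos_cube_mul_rpow hb1 hξ (A := 1 / 2) (by norm_num)
    simp only [Function.comp_apply]
    rw [mul_div_assoc, ← hs]
    simp only [J]
    push_cast
    ring
  have herr : Tendsto (fun ξ : ℝ => K * ξ ^ (-((b + 2) / 3))) atTop (nhds 0) := by
    simpa using (tendsto_rpow_neg_atTop (y := (b + 2) / 3) (by linarith)).const_mul K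
  have hzero := squeeze_zero_norm' (f := fun ξ : ℝ => ((ξ ^ ((1 - b) / 3) : ℝ) : ℂ) *
      (∫ t : ℝ, Complex.exp (-(Complex.I * ((ξ : ℂ) * (t : ℂ) ^ 3))) * (χ t : ℂ) *
          ((|t| ^ (-b) : ℝ) : ℂ)) - ((ξ ^ ((1 - b) / 3) : ℝ) : ℂ) * ((2 * J ξ : ℝ) : ℂ)) ?_ herr
  · simpa using hzero.add hmain
  · filter_upwards [eventually_gt_atTop 0] with ξ hξ
    rw [← mul_sub, norm_mul, Complex.norm_real, norm_of_nonneg (rpow_nonneg hξ.le _)]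
    refine (mul_le_mul_of_nonneg_left (hK ξ hξ) (rpow_nonneg hξ.le _)).trans_eq ?_
    rw [show -((b + 2) / 3) = (1 - b) / 3 - 1 by ring, rpow_sub_one hξ.ne']
    ring

theorem continuous_integral_exp_mul_abs_rpow {b : ℝ} (hb1 : b < 1) {χ : ℝ → ℝ}
    (hχ : Continuous χ) (hsupp : HasCompactSupport χ) :
    Continuous fun ξ : ℝ × ℝ => ∫ t : ℝ,
      Complex.exp (-(Complex.I * ((ξ.1 : ℂ) * (t : ℂ) + (ξ.2 : ℂ) * (t : ℂ) ^ 3))) *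
        (χ t : ℂ) * ((|t| ^ (-b) : ℝ) : ℂ) := by
  have hloc : LocallyIntegrable (fun t : ℝ => |t| ^ (-b)) volume := fun x =>
    ⟨Set.Icc (x - 1) (x + 1), Icc_mem_nhds (by linarith) (by linarith),
      (intervalIntegrable_iff_integrableOn_Icc_of_le (by linarith)).1
        (intervalIntegrable_abs_rpow (by linarith) _ _)⟩
  have hint := (hloc.integrable_smul_left_of_hasCompactSupport hχ hsupp).norm
  refine continuous_of_dominated (fun ξ => ?_) (fun ξ => ?_) hint ?_
  · exact Measurable.aestronglyMeasurable (by fun_prop)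
  · refine Eventually.of_forall fun t => le_of_eq ?_
    have : Complex.exp (-(Complex.I * ((ξ.1 : ℂ) * (t : ℂ) + (ξ.2 : ℂ) * (t : ℂ) ^ 3))) =
        Complex.exp (((-(ξ.1 * t + ξ.2 * t ^ 3) : ℝ) : ℂ) * Complex.I) := by
      push_cast; ring_nf
    rw [this, norm_mul, norm_mul, Complex.norm_exp_ofReal_mul_I, Complex.norm_real,
      Complex.norm_real, one_mul, smul_eq_mul, norm_mul]
  · exact Eventually.of_forall fun t => by fun_prop

theorem not_bound_of_tendsto {f : ℝ → ℂ} {q r : ℝ} {L : ℂ} (hL : L ≠ 0)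
    (hf : Tendsto (fun x : ℝ => ((x ^ q : ℝ) : ℂ) * f x) atTop (nhds L)) (hr : r < -q) (C : ℝ) :
    ¬ ∀ x : ℝ, 0 < x → ‖f x‖ ≤ C * x ^ r := by
  intro h
  have h0 : Tendsto (fun x : ℝ => C * x ^ (-(-q - r))) atTop (nhds 0) := by
    simpa using (tendsto_rpow_neg_atTop (y := -q - r) (by linarith)).const_mul C
  refine hL (tendsto_nhds_unique hf (squeeze_zero_norm' ?_ h0))
  filter_upwards [eventually_gt_atTop 0] with x hx
  rw [norm_mul, Complex.norm_real, norm_of_nonneg (rpow_nonneg hx.le _)]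
  refine (mul_le_mul_of_nonneg_left (h x hx) (rpow_nonneg hx.le _)).trans_eq ?_
  rw [show -(-q - r) = q + r by ring, rpow_add hx]
  ring

/-- A continuous multiplier that is bounded from `H^s` to `H^{s-r}` is pointwise bounded by the
corresponding power of the Bessel weight. -/
theorem norm_le_of_weighted_lintegral_bound {m : ℝ × ℝ → ℂ} (hm : Continuous m) {s r C : ℝ}
    (h : ∀ g : ℝ × ℝ → ℂ, Measurable g →
      (∫⁻ ξ : ℝ × ℝ, ENNReal.ofReal ((1 + ξ.1 ^ 2 + ξ.2 ^ 2) ^ (s - r)) *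
        (‖m ξ * g ξ‖₊ : ℝ≥0∞) ^ 2) ≤
      ENNReal.ofReal C * ∫⁻ ξ : ℝ × ℝ, ENNReal.ofReal ((1 + ξ.1 ^ 2 + ξ.2 ^ 2) ^ s) *
        (‖g ξ‖₊ : ℝ≥0∞) ^ 2) (ξ : ℝ × ℝ) :
    ‖m ξ‖ ≤ √(max C 0) * (1 + ξ.1 ^ 2 + ξ.2 ^ 2) ^ (r / 2) := by
  have hw : ∀ ξ : ℝ × ℝ, 0 < 1 + ξ.1 ^ 2 + ξ.2 ^ 2 := fun ξ => by positivity
  have hwc : ∀ p : ℝ, Continuous fun ξ : ℝ × ℝ => (1 + ξ.1 ^ 2 + ξ.2 ^ 2) ^ p := fun p =>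
    Continuous.rpow_const (by fun_prop) fun ξ => Or.inl (hw ξ).ne'
  set F : ℝ × ℝ → ℝ := fun ξ => (1 + ξ.1 ^ 2 + ξ.2 ^ 2) ^ (s - r) * ‖m ξ‖ ^ 2
  set G : ℝ × ℝ → ℝ := fun ξ => max C 0 * (1 + ξ.1 ^ 2 + ξ.2 ^ 2) ^ s
  have hF : Continuous F := (hwc _).mul (by fun_prop)
  have hG : Continuous G := continuous_const.mul (hwc _)
  have hae : (fun ξ => ENNReal.ofReal (F ξ)) ≤ᵐ[volume] fun ξ => ENNReal.ofReal (G ξ) := by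
    refine ae_le_of_forall_setLIntegral_le_of_sigmaFinite hF.measurable.ennreal_ofReal
      fun A hA _ => ?_
    have hgA := h (A.indicator 1) (measurable_one.indicator hA)
    rw [← lintegral_const_mul _ (by
      have := (hwc s).measurable
      have := (measurable_one (α := ℂ) (β := ℝ × ℝ)).indicator hA
      fun_prop)] at hgA
    rw [← lintegral_indicator hA, ← lintegral_indicator hA]
    refine (lintegral_congr fun ξ => ?_).trans_le (hgA.trans_eq (lintegral_congr fun ξ => ?_))
    · by_cases hξ : ξ ∈ A
      · simp only [hξ, Set.indicator_of_mem, Pi.one_apply, mul_one, F]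
        rw [ENNReal.ofReal_mul (rpow_nonneg (hw ξ).le _), ENNReal.ofReal_pow (norm_nonneg _),
          ofReal_norm, enorm_eq_nnnorm]
      · simp [hξ]
    · by_cases hξ : ξ ∈ A
      · simp only [hξ, Set.indicator_of_mem, Pi.one_apply, G]
        rw [ENNReal.ofReal_mul (le_max_right _ _)]
        simp
      · simp [hξ]
  have hle : ∀ ξ, F ξ ≤ G ξ := by
    have hae' : ∀ᵐ ξ : ℝ × ℝ, F ξ ≤ G ξ := hae.mono fun ξ hξ =>
      (ENNReal.ofReal_le_ofReal_iff
        (mul_nonneg (le_max_right _ _) (rpow_nonneg (hw ξ).le _))).1 hξ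
    have hopen : IsOpen {ξ | ¬ F ξ ≤ G ξ} := by
      simpa only [not_le] using isOpen_lt hG hF
    have hnull := (hopen.measure_eq_zero_iff volume).1 (ae_iff.1 hae')
    intro ξ
    by_contra hξ
    exact (Set.eq_empty_iff_forall_notMem.1 hnull ξ) hξ
  have hξ := hle ξ
  set w := 1 + ξ.1 ^ 2 + ξ.2 ^ 2 with hwdef
  have hw0 : 0 < w := hw ξ
  refine le_of_sq_le_sq ?_ (by positivity)
  rw [mul_pow, sq_sqrt (le_max_right _ _), ← rpow_natCast (w ^ (r / 2)), ← rpow_mul hw0.le,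
    show r / 2 * ((2 : ℕ) : ℝ) = r by push_cast; ring]
  refine le_of_mul_le_mul_left (hξ.trans_eq ?_) (rpow_pos_of_pos hw0 (s - r))
  simp only [G]
  rw [← hwdef, mul_left_comm, ← rpow_add hw0, sub_add_cancel]

/-- Sharpness of the Sobolev exponent `r = (2l-1)/6` for the fractional
integral `𝒥_{l+1/2}` along the cubic curve, `-1/2 < l < 1/2`.  Here `m l` is its Fourier
multiplier, `m_l(ξ) = ∫ e^{-i(ξ₁t+ξ₂t³)} χ(t)|t|^{-(l+1/2)} dt`.  The conclusion packages:
the existence of the nonzero limit `L` of the truncated oscillatory integrals; the asymptotics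
`ξ₂^{(1-2l)/6} m_l(0,ξ₂) → L/3`; (a) failure of any pointwise multiplier bound of order
`r < (2l-1)/6`; and (b) failure of `H^s → H^{s-r}` boundedness (expressed on the Fourier
transform side) for any `s` and any `r < (2l-1)/6`. -/
theorem stmt2 (l : ℝ) (hl1 : -(1/2 : ℝ) < l) (hl2 : l < 1/2)
    (χ : ℝ → ℝ) (hχsmooth : ContDiff ℝ (⊤ : ℕ∞) χ) (hχsupp : HasCompactSupport χ)
    (hχone : ∀ t : ℝ, |t| ≤ 1/2 → χ t = 1)
    (m : ℝ → ℝ → ℂ)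
    (hm : ∀ ξ₁ ξ₂ : ℝ, m ξ₁ ξ₂ =
      ∫ t : ℝ, Complex.exp (-(Complex.I * ((ξ₁ : ℂ) * (t : ℂ) + (ξ₂ : ℂ) * (t : ℂ) ^ 3))) *
        (χ t : ℂ) * ((|t| ^ (-(l + 1/2)) : ℝ) : ℂ)) :
    ∃ L : ℂ, L ≠ 0 ∧
      Tendsto (fun R : ℝ =>
          ∫ u in Set.Icc (-R) R,
            Complex.exp (-(Complex.I * (u : ℂ))) * ((|u| ^ (-((2 * l + 5)/6)) : ℝ) : ℂ))
        atTop (nhds L) ∧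
      Tendsto (fun ξ₂ : ℝ => ((ξ₂ ^ ((1 - 2 * l)/6) : ℝ) : ℂ) * m 0 ξ₂) atTop (nhds (L / 3)) ∧
      (∀ r : ℝ, r < (2 * l - 1)/6 →
        ¬ ∃ C : ℝ, ∀ ξ₁ ξ₂ : ℝ, ‖m ξ₁ ξ₂‖ ≤ C * (1 + Real.sqrt (ξ₁ ^ 2 + ξ₂ ^ 2)) ^ r) ∧
      (∀ s r : ℝ, r < (2 * l - 1)/6 →
        ¬ ∃ C : ℝ, ∀ g : ℝ × ℝ → ℂ, Measurable g →
          (∫⁻ ξ : ℝ × ℝ, ENNReal.ofReal ((1 + ξ.1 ^ 2 + ξ.2 ^ 2) ^ (s - r)) *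
              (‖m ξ.1 ξ.2 * g ξ‖₊ : ℝ≥0∞) ^ 2) ≤
            ENNReal.ofReal C *
              ∫⁻ ξ : ℝ × ℝ, ENNReal.ofReal ((1 + ξ.1 ^ 2 + ξ.2 ^ 2) ^ s) *
                (‖g ξ‖₊ : ℝ≥0∞) ^ 2) := by
  have hχ : ContDiff ℝ 1 χ := hχsmooth.of_le (by exact_mod_cast le_top)
  have hb : (l + 1 / 2 + 2) / 3 = (2 * l + 5) / 6 := by ring
  have hq : (1 - (l + 1 / 2)) / 3 = (1 - 2 * l) / 6 := by ring
  obtain ⟨c, hc0, hc⟩ := exists_pos_tendsto_integral_cos_mul_rpow (a := (2 * l + 5) / 6)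
    (by linarith) (by linarith)
  have hasymp := tendsto_rpow_mul_integral_exp_cube (b := l + 1 / 2) (by linarith) (by linarith)
    hχ hχsupp hχone (by rwa [hb])
  have hm0 : ∀ ξ : ℝ, m 0 ξ = ∫ t : ℝ, Complex.exp (-(Complex.I * ((ξ : ℂ) * (t : ℂ) ^ 3))) *
      (χ t : ℂ) * ((|t| ^ (-(l + 1 / 2)) : ℝ) : ℂ) := fun ξ => by
    rw [hm]; simp
  simp only [← hm0, hq] at hasymp
  have hL : ((2 * c : ℝ) : ℂ) ≠ 0 := Complex.ofReal_ne_zero.2 (by positivity)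
  have hnot : ∀ r : ℝ, r < (2 * l - 1) / 6 → ∀ C : ℝ,
      ¬ ∀ x : ℝ, 0 < x → ‖m 0 x‖ ≤ C * x ^ r := fun r hr C =>
    not_bound_of_tendsto (div_ne_zero hL (by norm_num)) hasymp (by linarith) C
  refine ⟨((2 * c : ℝ) : ℂ), hL, ?_, hasymp, ?_, ?_⟩
  · refine ((Complex.continuous_ofReal.tendsto _).comp (hc.const_mul 2)).congr' ?_
    filter_upwards [eventually_ge_atTop 0] with R hR
    exact (integral_exp_mul_abs_rpow_eq (by linarith) hR).symm
  · rintro r hr ⟨C, hC⟩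
    refine hnot r hr |C| fun x hx => (hC 0 x).trans ?_
    have hsqrt : √((0 : ℝ) ^ 2 + x ^ 2) = x := by simp [sqrt_sq hx.le]
    rw [hsqrt]
    refine (mul_le_mul_of_nonneg_right (le_abs_self C) (by positivity)).trans ?_
    exact mul_le_mul_of_nonneg_left
      (rpow_le_rpow_of_nonpos hx (by linarith) (by linarith)) (abs_nonneg C)
  · rintro s r hr ⟨C, hC⟩
    have hcont : Continuous fun ξ : ℝ × ℝ => m ξ.1 ξ.2 := by
      simp only [hm]
      exact continuous_integral_exp_mul_abs_rpow (by linarith) hχ.continuous hχsupp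
    refine hnot r hr (√(max C 0)) fun x hx =>
      (norm_le_of_weighted_lintegral_bound hcont hC (0, x)).trans ?_
    refine mul_le_mul_of_nonneg_left ?_ (sqrt_nonneg _)
    have hx2 : x ^ r = (x ^ 2) ^ (r / 2) := by
      rw [← rpow_natCast x 2, ← rpow_mul hx.le]
      congr 1; push_cast; ring
    rw [hx2]
    exact rpow_le_rpow_of_nonpos (by positivity) (by norm_num) (by linarith)
end

section
/- Let χ ∈ C_0^∞(ℝ) with χ ≡ 1 on [-1/2,1/2], and set m(ξ₂) = ∫_ℝ e^{-iξ₂ t³} χ(t) log|t| dt (an absolutely convergent integral). Then there exist c > 0 and T ≥ 2 such that |m(ξ₂)| ≥ c ξ₂^{-1/3} log ξ₂ for all ξ₂ ≥ T. In particular |m(ξ₂)| · ξ₂^{1/3} → ∞ as ξ₂ → +∞, so there is no constant C with |m(ξ₂)| ≤ C(1+|ξ₂|)^{-1/3} for all ξ₂; this shows one cannot remove the ε-loss in the endpoint case l = -1/2 of the Sobolev estimates for operators in I^{p,l}(Δ,C₀). -/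
open MeasureTheory Filter Real

lemma one_fifth_le_integral_cos_cube {S : ℝ} (h₁ : 1 ≤ S) (h₂ : S ≤ 17 / 10) :
    1 / 5 ≤ ∫ s in (0 : ℝ)..S, cos (s ^ 3) := by
  have hint : ∀ a b : ℝ, IntervalIntegrable (fun s : ℝ => cos (s ^ 3)) volume a b :=
    fun a b => (by fun_prop : Continuous fun s : ℝ => cos (s ^ 3)).intervalIntegrable a b
  rw [← intervalIntegral.integral_add_adjacent_intervals (hint 0 1) (hint 1 S)]
  have hleft : (13 / 14 : ℝ) ≤ ∫ s in (0 : ℝ)..1, cos (s ^ 3) := by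
    have hpoly : ∫ s in (0 : ℝ)..1, (1 - s ^ 6 / 2) = 13 / 14 := by
      rw [intervalIntegral.integral_sub (by simp)
        ((by fun_prop : Continuous fun s : ℝ => s ^ 6 / 2).intervalIntegrable _ _)]
      simp only [intervalIntegral.integral_div, integral_pow, intervalIntegral.integral_const]
      norm_num
    rw [← hpoly]
    refine intervalIntegral.integral_mono_on zero_le_one
      ((by fun_prop : Continuous fun s : ℝ => 1 - s ^ 6 / 2).intervalIntegrable _ _)
      (hint 0 1) fun s _ => ?_
    have := @one_sub_sq_div_two_le_cos (s ^ 3)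
    rwa [← pow_mul] at this
  have hright : -(S - 1) ≤ ∫ s in (1 : ℝ)..S, cos (s ^ 3) := by
    have : ∫ _ in (1 : ℝ)..S, (-1 : ℝ) = -(S - 1) := by simp
    rw [← this]
    exact intervalIntegral.integral_mono_on h₁ (by simp) (hint 1 S) fun s _ => neg_one_le_cos _
  linarith

lemma intervalIntegrable_cos_mul_mul_log {χ : ℝ → ℝ} (hχ : Continuous χ) (l a b : ℝ) :
    IntervalIntegrable (fun t => cos ((l * t) ^ 3) * χ t * log t) volume a b :=
  intervalIntegral.intervalIntegrable_log'.continuousOn_mul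
    (by fun_prop : Continuous fun t => cos ((l * t) ^ 3) * χ t).continuousOn

lemma intervalIntegrable_cos_mul_neg_log (l a b : ℝ) :
    IntervalIntegrable (fun t => cos ((l * t) ^ 3) * -log t) volume a b :=
  intervalIntegral.intervalIntegrable_log'.neg.continuousOn_mul
    (by fun_prop : Continuous fun t : ℝ => cos ((l * t) ^ 3)).continuousOn

/-- Non-stationary phase: one integration by parts gains the factor `l⁻³`. -/
lemma exists_abs_integral_mul_cos_cube_le {g : ℝ → ℝ} (hg : ContDiffOn ℝ 1 g (Set.Ioi 0))
    {a b : ℝ} (ha : 0 < a) (hab : a ≤ b) :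
    ∃ C : ℝ, ∀ l : ℝ, 0 < l →
      |∫ t in a..b, g t * (cos ((l * t) ^ 3) * (3 * t ^ 2))| ≤ C / l ^ 3 := by
  have hsub : Set.uIcc a b ⊆ Set.Ioi 0 := by
    rw [Set.uIcc_of_le hab]
    exact fun x hx => ha.trans_le hx.1
  have hg' : ContinuousOn (deriv g) (Set.uIcc a b) :=
    (hg.continuousOn_deriv_of_isOpen isOpen_Ioi le_rfl).mono hsub
  obtain ⟨M, hM⟩ := isCompact_uIcc.exists_bound_of_continuousOn hg'
  refine ⟨|g b| + |g a| + M * |b - a|, fun l hl => ?_⟩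
  have hv : ∀ x ∈ Set.uIcc a b, HasDerivAt (fun t : ℝ => sin ((l * t) ^ 3) / l ^ 3)
      (cos ((l * x) ^ 3) * (3 * x ^ 2)) x := fun x _ => by
    have h := ((((hasDerivAt_id' x).const_mul l).pow 3).sin).div_const (l ^ 3)
    refine h.congr_deriv ?_
    simp only [Pi.pow_apply, mul_pow]
    field_simp
    push_cast
    ring
  have hu : ∀ x ∈ Set.uIcc a b, HasDerivAt g (deriv g x) x := fun x hx =>
    ((hg.differentiableOn one_ne_zero).differentiableAt
      (isOpen_Ioi.mem_nhds (hsub hx))).hasDerivAt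
  rw [intervalIntegral.integral_mul_deriv_eq_deriv_mul hu hv hg'.intervalIntegrable
    ((by fun_prop : Continuous fun x : ℝ => cos ((l * x) ^ 3) * (3 * x ^ 2)).intervalIntegrable
      _ _)]
  have hl3 : 0 < l ^ 3 := by positivity
  have hsin : ∀ x : ℝ, |sin ((l * x) ^ 3) / l ^ 3| ≤ 1 / l ^ 3 := fun x => by
    rw [abs_div, abs_of_pos hl3]
    gcongr
    exact abs_sin_le_one _
  have hI : |∫ x in a..b, deriv g x * (sin ((l * x) ^ 3) / l ^ 3)|
      ≤ M * (1 / l ^ 3) * |b - a| := by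
    rw [← norm_eq_abs]
    refine intervalIntegral.norm_integral_le_of_norm_le_const fun x hx => ?_
    rw [norm_mul]
    have h := hM x (Set.uIoc_subset_uIcc hx)
    exact mul_le_mul h (hsin x) (norm_nonneg _) ((norm_nonneg _).trans h)
  have hbound : ∀ x, |g x * (sin ((l * x) ^ 3) / l ^ 3)| ≤ |g x| * (1 / l ^ 3) := fun x => by
    rw [abs_mul]
    exact mul_le_mul_of_nonneg_left (hsin x) (abs_nonneg _)
  calc _ ≤ |g b| * (1 / l ^ 3) + |g a| * (1 / l ^ 3) + M * (1 / l ^ 3) * |b - a| :=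
        (abs_sub _ _).trans (add_le_add ((abs_sub _ _).trans
          (add_le_add (hbound b) (hbound a))) hI)
    _ = _ := by ring

/-- The part of the oscillatory integral past the first minimum `3π/2` of the sine
is nonnegative. -/
lemma integral_cos_cube_mul_neg_log_nonneg {l A B : ℝ} (hl : 0 < l) (hA : 0 < A) (hAB : A ≤ B)
    (hB : B ≤ 1) (hsin : sin ((l * A) ^ 3) = -1) :
    0 ≤ ∫ t in A..B, cos ((l * t) ^ 3) * -log t := by
  set F : ℝ → ℝ := fun t => (sin ((l * t) ^ 3) + 1) * (-log t / (3 * l ^ 3 * t ^ 2)) with hF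
  have hderiv : ∀ x : ℝ, 0 < x → HasDerivAt F
      (cos ((l * x) ^ 3) * -log x
        + (sin ((l * x) ^ 3) + 1) * ((-1 + 2 * log x) / (3 * l ^ 3 * x ^ 3))) x := by
    intro x hx
    have h₁ := ((((hasDerivAt_id' x).const_mul l).pow 3).sin).add_const (1 : ℝ)
    have h₂ := (hasDerivAt_log hx.ne').neg.div (((hasDerivAt_id' x).pow 2).const_mul (3 * l ^ 3))
      (by simp; exact ⟨hl.ne', hx.ne'⟩)
    refine (h₁.mul h₂).congr_deriv ?_
    simp
    field_simp
  have h := intervalIntegral.sub_le_integral_of_hasDeriv_right_of_le hAB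
    (fun x hx => (hderiv x (hA.trans_le hx.1)).continuousAt.continuousWithinAt)
    (fun x hx => (hderiv x (hA.trans hx.1)).hasDerivWithinAt)
    ((intervalIntegrable_iff_integrableOn_Icc_of_le hAB).1
      (intervalIntegrable_cos_mul_neg_log l A B))
    (fun x hx => by
      have hx0 : 0 < x := hA.trans hx.1
      have hlog : log x ≤ 0 := log_nonpos hx0.le (hx.2.le.trans hB)
      have : (sin ((l * x) ^ 3) + 1) * ((-1 + 2 * log x) / (3 * l ^ 3 * x ^ 3)) ≤ 0 :=
        mul_nonpos_of_nonneg_of_nonpos (by linarith [neg_one_le_sin ((l * x) ^ 3)])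
          (div_nonpos_of_nonpos_of_nonneg (by linarith) (by positivity))
      linarith)
  have hFA : F A = 0 := by simp [hF, hsin]
  have hFB : 0 ≤ F B := mul_nonneg (by linarith [neg_one_le_sin ((l * B) ^ 3)])
    (div_nonneg (neg_nonneg.2 (log_nonpos (hA.le.trans hAB) hB)) (by positivity))
  linarith

/-- Up to the first minimum `3π/2` of the sine, the weight `-log t` may be replaced by its
value at the sign change of the cosine. -/
lemma neg_log_mul_integral_cos_cube_le {l a A : ℝ} (hl : 0 < l) (ha : 0 < a) (haA : a ≤ A)
    (h₁ : (l * a) ^ 3 = π / 2) (h₂ : (l * A) ^ 3 = π + π / 2) :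
    -log a * ∫ t in (0 : ℝ)..A, cos ((l * t) ^ 3)
      ≤ ∫ t in (0 : ℝ)..A, cos ((l * t) ^ 3) * -log t := by
  rw [← intervalIntegral.integral_const_mul]
  refine intervalIntegral.integral_mono_on_of_le_Ioo (ha.le.trans haA)
    ((by fun_prop : Continuous fun t : ℝ => -log a * cos ((l * t) ^ 3)).intervalIntegrable _ _)
    (intervalIntegrable_cos_mul_neg_log l 0 A) fun t ht => ?_
  rcases le_total t a with hta | hta
  · have hc : 0 ≤ cos ((l * t) ^ 3) := by
      apply cos_nonneg_of_neg_pi_div_two_le_of_le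
      · have : 0 ≤ (l * t) ^ 3 := pow_nonneg (mul_nonneg hl.le ht.1.le) 3
        linarith [pi_pos]
      · rw [← h₁]
        exact pow_le_pow_left₀ (mul_nonneg hl.le ht.1.le) (mul_le_mul_of_nonneg_left hta hl.le) 3
    nlinarith [log_le_log ht.1 hta]
  · have hc : cos ((l * t) ^ 3) ≤ 0 := by
      apply cos_nonpos_of_pi_div_two_le_of_le
      · rw [← h₁]
        exact pow_le_pow_left₀ (mul_nonneg hl.le ha.le) (mul_le_mul_of_nonneg_left hta hl.le) 3
      · rw [← h₂]
        exact pow_le_pow_left₀ (mul_nonneg hl.le ht.1.le)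
          (mul_le_mul_of_nonneg_left ht.2.le hl.le) 3
    nlinarith [log_le_log ha hta]

lemma log_div_le_integral_cos_cube_mul_neg_log {l : ℝ} (hl : 4 ≤ l) :
    log l / (10 * l) ≤ ∫ t in (0 : ℝ)..1 / 2, cos ((l * t) ^ 3) * -log t := by
  have hl0 : 0 < l := by linarith
  have hcube : ∀ x : ℝ, 0 ≤ x → (x ^ ((1 : ℝ) / 3)) ^ 3 = x := fun x hx => by
    rw [← rpow_natCast, ← rpow_mul hx]
    norm_num
  obtain ⟨s, hs0, hs⟩ : ∃ s : ℝ, 0 < s ∧ s ^ 3 = π / 2 :=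
    ⟨(π / 2) ^ ((1 : ℝ) / 3), by positivity, hcube _ (by positivity)⟩
  obtain ⟨S, hS0, hS⟩ : ∃ S : ℝ, 0 < S ∧ S ^ 3 = π + π / 2 :=
    ⟨(π + π / 2) ^ ((1 : ℝ) / 3), by positivity, hcube _ (by positivity)⟩
  have hπ₁ := pi_gt_three
  have hπ₂ := pi_lt_d2
  have hs2 : s ≤ 2 := le_of_pow_le_pow_left₀ three_ne_zero (by norm_num) (by rw [hs]; linarith)
  have hsS : s ≤ S := le_of_pow_le_pow_left₀ three_ne_zero hS0.le (by rw [hs, hS]; linarith)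
  have hS1 : 1 ≤ S := le_of_pow_le_pow_left₀ three_ne_zero hS0.le (by rw [hS]; linarith)
  have hS2 : S ≤ 17 / 10 :=
    le_of_pow_le_pow_left₀ three_ne_zero (by norm_num) (by rw [hS]; norm_num; linarith)
  have hmul : ∀ x : ℝ, l * (x / l) = x := fun x => by field_simp
  have hA : S / l ≤ 1 / 2 := by
    rw [div_le_iff₀ hl0]
    linarith
  have hmain := neg_log_mul_integral_cos_cube_le (l := l) (a := s / l) (A := S / l) hl0
    (by positivity) (by gcongr) (by rw [hmul, hs]) (by rw [hmul, hS])
  have htail := integral_cos_cube_mul_neg_log_nonneg (l := l) (A := S / l) (B := 1 / 2) hl0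
    (by positivity) hA (by norm_num) (by
      rw [hmul, hS, add_comm, sin_add_pi, sin_pi_div_two])
  rw [← intervalIntegral.integral_add_adjacent_intervals
    (intervalIntegrable_cos_mul_neg_log l 0 (S / l))
    (intervalIntegrable_cos_mul_neg_log l (S / l) (1 / 2))]
  rw [intervalIntegral.integral_comp_mul_left (fun x => cos (x ^ 3)) hl0.ne', hmul, mul_zero,
    smul_eq_mul] at hmain
  have hK := one_fifth_le_integral_cos_cube hS1 hS2
  have hlog : log l / 2 ≤ -log (s / l) := by
    rw [log_div hs0.ne' hl0.ne']
    have h₁ : log s ≤ log 2 := log_le_log hs0 hs2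
    have h₂ : log 4 ≤ log l := log_le_log (by norm_num) hl
    have h₃ : log 4 = 2 * log 2 := by
      rw [show (4 : ℝ) = 2 ^ 2 by norm_num, log_pow]
      norm_num
    linarith
  have hlog0 : 0 ≤ log l := log_nonneg (by linarith)
  calc log l / (10 * l) = log l / 2 * (l⁻¹ * (1 / 5)) := by
        field_simp
        ring
    _ ≤ -log (s / l) * (l⁻¹ * ∫ x in (0 : ℝ)..S, cos (x ^ 3)) :=
        mul_le_mul hlog (by gcongr) (by positivity) (by linarith)
    _ ≤ _ := by linarith

lemma exists_integral_cos_cube_mul_log_le {χ : ℝ → ℝ} (hχ : ContDiff ℝ 1 χ)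
    (hχone : ∀ t : ℝ, |t| ≤ 1 / 2 → χ t = 1) {R : ℝ} (hR : 1 / 2 ≤ R) :
    ∃ C : ℝ, ∀ l : ℝ, 4 ≤ l →
      ∫ t in (0 : ℝ)..R, cos ((l * t) ^ 3) * χ t * log t ≤ -(log l / (10 * l)) + C / l ^ 3 := by
  have hg : ContDiffOn ℝ 1 (fun t : ℝ => χ t * log t / (3 * t ^ 2)) (Set.Ioi 0) := by
    refine (hχ.contDiffOn.mul (contDiffOn_log.mono fun x hx => ne_of_gt hx)).div
      (by fun_prop) fun x hx => ?_
    have : 0 < x := hx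
    positivity
  obtain ⟨C, hC⟩ := exists_abs_integral_mul_cos_cube_le hg (by norm_num : (0 : ℝ) < 1 / 2) hR
  refine ⟨C, fun l hl => ?_⟩
  have hint := intervalIntegrable_cos_mul_mul_log hχ.continuous l
  rw [← intervalIntegral.integral_add_adjacent_intervals (hint 0 (1 / 2)) (hint (1 / 2) R)]
  have h₁ : ∫ t in (0 : ℝ)..1 / 2, cos ((l * t) ^ 3) * χ t * log t
      = -∫ t in (0 : ℝ)..1 / 2, cos ((l * t) ^ 3) * -log t := by
    rw [← intervalIntegral.integral_neg]
    refine intervalIntegral.integral_congr fun t ht => ?_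
    rw [Set.uIcc_of_le (by norm_num)] at ht
    simp only [hχone t (by rw [abs_of_nonneg ht.1]; exact ht.2)]
    ring
  have h₂ : ∫ t in (1 / 2 : ℝ)..R, cos ((l * t) ^ 3) * χ t * log t
      = ∫ t in (1 / 2 : ℝ)..R, χ t * log t / (3 * t ^ 2) * (cos ((l * t) ^ 3) * (3 * t ^ 2)) := by
    refine intervalIntegral.integral_congr fun t ht => ?_
    rw [Set.uIcc_of_le hR] at ht
    have : t ≠ 0 := by linarith [ht.1]
    field_simp
  rw [h₁, h₂]
  have := log_div_le_integral_cos_cube_mul_neg_log hl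
  have := le_of_abs_le (hC l (by linarith))
  linarith

lemma exists_integral_cos_cube_mul_log_abs_le {χ : ℝ → ℝ} (hχ : ContDiff ℝ 1 χ)
    (hχsupp : HasCompactSupport χ) (hχone : ∀ t : ℝ, |t| ≤ 1 / 2 → χ t = 1) :
    ∃ C : ℝ, ∀ l : ℝ, 4 ≤ l →
      ∫ t : ℝ, cos ((l * t) ^ 3) * χ t * log |t| ≤ -(log l / (5 * l)) + C / l ^ 3 := by
  obtain ⟨r, hr⟩ := hχsupp.isCompact.isBounded.subset_ball 0
  set R := max r 1
  have hR : 1 / 2 ≤ R := (by norm_num : (1 / 2 : ℝ) ≤ 1).trans (le_max_right _ _)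
  obtain ⟨C₁, hC₁⟩ := exists_integral_cos_cube_mul_log_le hχ hχone hR
  obtain ⟨C₂, hC₂⟩ := exists_integral_cos_cube_mul_log_le (χ := fun t => χ (-t))
    (hχ.comp contDiff_neg) (fun t ht => hχone _ (by rwa [abs_neg])) hR
  refine ⟨C₁ + C₂, fun l hl => ?_⟩
  simp only [log_abs]
  have hint := intervalIntegrable_cos_mul_mul_log hχ.continuous l
  have hsupp : Function.support (fun t => cos ((l * t) ^ 3) * χ t * log t) ⊆ Set.Ioc (-R) R := by
    intro t ht
    have hχt : χ t ≠ 0 := fun h => ht (by simp [h])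
    have := hr (subset_tsupport χ hχt)
    rw [mem_ball_zero_iff, norm_eq_abs, abs_lt] at this
    have hrR : r ≤ R := le_max_left _ _
    exact ⟨by linarith [this.1], by linarith [this.2]⟩
  rw [← intervalIntegral.integral_eq_integral_of_support_subset hsupp,
    ← intervalIntegral.integral_add_adjacent_intervals (hint (-R) 0) (hint 0 R)]
  have hneg : ∫ t in (-R)..0, cos ((l * t) ^ 3) * χ t * log t
      = ∫ t in (0 : ℝ)..R, cos ((l * t) ^ 3) * χ (-t) * log t := by
    have h := intervalIntegral.integral_comp_neg (a := 0) (b := R)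
      (fun t => cos ((l * t) ^ 3) * χ t * log t)
    rw [neg_zero] at h
    rw [← h]
    refine intervalIntegral.integral_congr fun t _ => ?_
    simp only [log_neg_eq_log, mul_neg, Odd.neg_pow (by decide : Odd 3), cos_neg]
  rw [hneg]
  calc _ ≤ (-(log l / (10 * l)) + C₂ / l ^ 3) + (-(log l / (10 * l)) + C₁ / l ^ 3) :=
        add_le_add (hC₂ l hl) (hC₁ l hl)
    _ = _ := by
        field_simp
        ring

lemma integrable_exp_cube_mul_mul_log_abs {χ : ℝ → ℝ} (hχ : Continuous χ)
    (hχsupp : HasCompactSupport χ) (ξ : ℝ) :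
    Integrable (fun t : ℝ => Complex.exp (-(Complex.I * (ξ : ℂ) * (t : ℂ) ^ 3)) * (χ t : ℂ) *
      ((log |t| : ℝ) : ℂ)) := by
  obtain ⟨r, hr⟩ := hχsupp.isCompact.isBounded.subset_closedBall 0
  simp only [log_abs]
  rw [← integrableOn_iff_integrable_of_support_subset (s := Set.uIcc (-r) r)]
  · rw [← intervalIntegrable_iff']
    have hlog : IntervalIntegrable (fun t : ℝ => ((log t : ℝ) : ℂ)) volume (-r) r :=
      ⟨intervalIntegral.intervalIntegrable_log'.1.ofReal,
        intervalIntegral.intervalIntegrable_log'.2.ofReal⟩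
    exact hlog.continuousOn_mul (by fun_prop : Continuous fun t : ℝ =>
      Complex.exp (-(Complex.I * (ξ : ℂ) * (t : ℂ) ^ 3)) * (χ t : ℂ)).continuousOn
  · intro t ht
    have hχt : χ t ≠ 0 := fun h => ht (by simp [h])
    have := hr (subset_tsupport χ hχt)
    rw [mem_closedBall_zero_iff, norm_eq_abs, abs_le] at this
    rw [Set.uIcc_of_le (by linarith)]
    exact this

lemma exists_log_div_le_norm_integral_exp_cube {χ : ℝ → ℝ} (hχ : ContDiff ℝ 1 χ)
    (hχsupp : HasCompactSupport χ) (hχone : ∀ t : ℝ, |t| ≤ 1 / 2 → χ t = 1) :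
    ∃ L : ℝ, 4 ≤ L ∧ ∀ l : ℝ, L ≤ l → log l / (10 * l) ≤
      ‖∫ t : ℝ, Complex.exp (-(Complex.I * ((l ^ 3 : ℝ) : ℂ) * (t : ℂ) ^ 3)) * (χ t : ℂ) *
        ((log |t| : ℝ) : ℂ)‖ := by
  obtain ⟨C, hC⟩ := exists_integral_cos_cube_mul_log_abs_le hχ hχsupp hχone
  refine ⟨max 4 (10 * C), le_max_left _ _, fun l hl => ?_⟩
  have hl4 : 4 ≤ l := (le_max_left _ _).trans hl
  have hlC : 10 * C ≤ l := (le_max_right _ _).trans hl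
  have hl0 : 0 < l := by linarith
  have hre : ∫ t : ℝ, cos ((l * t) ^ 3) * χ t * log |t| =
      (∫ t : ℝ, Complex.exp (-(Complex.I * ((l ^ 3 : ℝ) : ℂ) * (t : ℂ) ^ 3)) * (χ t : ℂ) *
        ((log |t| : ℝ) : ℂ)).re := by
    have h := integral_re
      (integrable_exp_cube_mul_mul_log_abs hχ.continuous hχsupp (l ^ 3))
    simp only [RCLike.re_eq_complex_re] at h
    rw [← h]
    refine integral_congr_ae (ae_of_all _ fun t => ?_)
    have harg : -(Complex.I * ((l ^ 3 : ℝ) : ℂ) * (t : ℂ) ^ 3)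
        = ((-(l * t) ^ 3 : ℝ) : ℂ) * Complex.I := by
      push_cast
      ring
    simp only [harg, Complex.re_mul_ofReal, Complex.exp_ofReal_mul_I_re, cos_neg]
  have hbound := hC l hl4
  rw [hre] at hbound
  have hlog : 1 ≤ log l := by
    rw [le_log_iff_exp_le hl0]
    linarith [exp_one_lt_d9]
  have herr : C / l ^ 3 ≤ log l / (10 * l) := by
    rw [div_le_div_iff₀ (by positivity) (by positivity)]
    nlinarith [mul_nonneg (sub_nonneg.2 hlog) (by positivity : 0 ≤ l ^ 3),
      mul_le_mul_of_nonneg_right hlC hl0.le, mul_nonneg (sq_nonneg l) (by linarith : 0 ≤ l - 1)]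
  have hsplit : log l / (5 * l) = log l / (10 * l) + log l / (10 * l) := by
    field_simp
    norm_num
  refine le_trans ?_ (Complex.abs_re_le_norm _)
  refine le_trans ?_ (neg_le_abs _)
  linarith

/-- Logarithmic endpoint `l = -1/2`: with
`m(ξ₂) = ∫ e^{-iξ₂t³} χ(t) log|t| dt` (an absolutely convergent integral),
`|m(ξ₂)| ≥ c ξ₂^{-1/3} log ξ₂` for large `ξ₂`; in particular `|m(ξ₂)| ξ₂^{1/3} → ∞`
and no bound `|m(ξ₂)| ≤ C (1+|ξ₂|)^{-1/3}` can hold.  This shows the `ε`-loss at the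
endpoint `l = -1/2` of the Sobolev estimates for `I^{p,l}(Δ,C₀)` cannot be removed. -/
theorem stmt3 (χ : ℝ → ℝ) (hχsmooth : ContDiff ℝ (⊤ : ℕ∞) χ) (hχsupp : HasCompactSupport χ)
    (hχone : ∀ t : ℝ, |t| ≤ 1/2 → χ t = 1)
    (m : ℝ → ℂ)
    (hm : ∀ ξ₂ : ℝ, m ξ₂ =
      ∫ t : ℝ, Complex.exp (-(Complex.I * (ξ₂ : ℂ) * (t : ℂ) ^ 3)) * (χ t : ℂ) *
        ((Real.log |t| : ℝ) : ℂ)) :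
    (∀ ξ₂ : ℝ, Integrable (fun t : ℝ =>
        Complex.exp (-(Complex.I * (ξ₂ : ℂ) * (t : ℂ) ^ 3)) * (χ t : ℂ) *
          ((Real.log |t| : ℝ) : ℂ))) ∧
    (∃ c : ℝ, 0 < c ∧ ∃ T : ℝ, 2 ≤ T ∧
      ∀ ξ₂ : ℝ, T ≤ ξ₂ → c * ξ₂ ^ (-(1 : ℝ)/3) * Real.log ξ₂ ≤ ‖m ξ₂‖) ∧
    Tendsto (fun ξ₂ : ℝ => ‖m ξ₂‖ * ξ₂ ^ ((1 : ℝ)/3)) atTop atTop ∧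
    ¬ ∃ C : ℝ, ∀ ξ₂ : ℝ, ‖m ξ₂‖ ≤ C * (1 + |ξ₂|) ^ (-(1 : ℝ)/3) := by
  have hχ1 : ContDiff ℝ 1 χ := hχsmooth.of_le (by exact_mod_cast le_top)
  obtain ⟨L, hL, hbound⟩ := exists_log_div_le_norm_integral_exp_cube hχ1 hχsupp hχone
  have hlower : ∀ ξ : ℝ, L ^ 3 ≤ ξ →
      1 / 30 * ξ ^ (-(1 : ℝ) / 3) * Real.log ξ ≤ ‖m ξ‖ := by
    intro ξ hξ
    have hξ0 : 0 < ξ := lt_of_lt_of_le (by positivity) hξ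
    have hcube : (ξ ^ ((1 : ℝ) / 3)) ^ 3 = ξ := by
      rw [← rpow_natCast, ← rpow_mul hξ0.le]
      norm_num
    have hle : L ≤ ξ ^ ((1 : ℝ) / 3) :=
      le_of_pow_le_pow_left₀ three_ne_zero (by positivity) (by rwa [hcube])
    have h := hbound _ hle
    rw [hcube, ← hm, log_rpow hξ0] at h
    refine le_trans (le_of_eq ?_) h
    rw [neg_div, rpow_neg hξ0.le]
    field_simp
    ring
  have htend : Tendsto (fun ξ₂ : ℝ => ‖m ξ₂‖ * ξ₂ ^ ((1 : ℝ)/3)) atTop atTop := by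
    refine tendsto_atTop_mono' _ ?_
      (tendsto_log_atTop.const_mul_atTop (by norm_num : (0 : ℝ) < 1 / 30))
    filter_upwards [eventually_ge_atTop (L ^ 3)] with ξ hξ
    have hξ0 : 0 < ξ := lt_of_lt_of_le (by positivity) hξ
    have hinv : ξ ^ (-(1 : ℝ) / 3) * ξ ^ ((1 : ℝ) / 3) = 1 := by
      rw [← rpow_add hξ0]
      norm_num
    calc 1 / 30 * Real.log ξ
        = 1 / 30 * ξ ^ (-(1 : ℝ) / 3) * Real.log ξ * ξ ^ ((1 : ℝ) / 3) := by
          linear_combination (-(1 / 30 * Real.log ξ)) * hinv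
      _ ≤ _ := mul_le_mul_of_nonneg_right (hlower ξ hξ) (by positivity)
  refine ⟨integrable_exp_cube_mul_mul_log_abs hχ1.continuous hχsupp,
    ⟨1 / 30, by norm_num, L ^ 3, ?_, hlower⟩, htend, ?_⟩
  · calc (2 : ℝ) ≤ 4 ^ 3 := by norm_num
      _ ≤ L ^ 3 := by gcongr
  · rintro ⟨C, hC⟩
    obtain ⟨ξ, hξ, hξ0⟩ := ((htend.eventually_gt_atTop |C|).and (eventually_gt_atTop 0)).exists
    have hratio : (1 + |ξ|) ^ (-(1 : ℝ) / 3) * ξ ^ ((1 : ℝ) / 3) ≤ 1 := by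
      rw [abs_of_pos hξ0, neg_div, rpow_neg (by positivity), ← div_eq_inv_mul]
      refine div_le_one_of_le₀ (rpow_le_rpow hξ0.le (by linarith) (by norm_num)) (by positivity)
    have : ‖m ξ‖ * ξ ^ ((1 : ℝ) / 3) ≤ |C| :=
      calc ‖m ξ‖ * ξ ^ ((1 : ℝ) / 3)
          ≤ C * (1 + |ξ|) ^ (-(1 : ℝ) / 3) * ξ ^ ((1 : ℝ) / 3) :=
            mul_le_mul_of_nonneg_right (hC ξ) (by positivity)
        _ = C * ((1 + |ξ|) ^ (-(1 : ℝ) / 3) * ξ ^ ((1 : ℝ) / 3)) := mul_assoc _ _ _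
        _ ≤ |C| * ((1 + |ξ|) ^ (-(1 : ℝ) / 3) * ξ ^ ((1 : ℝ) / 3)) :=
            mul_le_mul_of_nonneg_right (le_abs_self C) (by positivity)
        _ ≤ |C| * 1 := mul_le_mul_of_nonneg_left hratio (abs_nonneg C)
        _ = |C| := mul_one _
    exact absurd hξ this.not_gt
end

section
/- Let P, L ∈ ℝ, 0 < δ < 1/2, and C₀ > 0. Let a(x,y;θ₂;θ₁) be a symbol-valued symbol of orders (P,L) with dominant variable θ₂ on ℝ²×ℝ²×ℝ², supported in the region {(1+θ₁²)^{1/2} ≤ C₀ (1+θ₂²)^{δ/2}}. Define ã(x,y;θ₂) = ∫_ℝ e^{i(x₁-y₁)θ₁} a(x,y;θ₂;θ₁) dθ₁ (an absolutely convergent integral). Then ã is a symbol of order M and type (1,δ) in θ₂: for every integer m ≥ 0 and multi-index γ in (x,y) there is C with |∂_{θ₂}^m ∂_{(x,y)}^γ ã(x,y;θ₂)| ≤ C (1+θ₂²)^{(M - m + δ|γ|)/2}, where M = P + δ(L+1) if L > -1, M = P if L < -1, and, if L = -1, the estimate holds with M = P + ε for every ε > 0. -/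
open MeasureTheory Filter Real

noncomputable section

/-- The ambient space of variables `z = ((x,y),(θ₂,θ₁))`, with `x, y ∈ ℝ²`. -/
abbrev E2 : Type := ((ℝ × ℝ) × (ℝ × ℝ)) × ℝ × ℝ

/-- A direction in the `θ₂`-block. -/
def IsTheta2Dir (v : E2) : Prop := v.1 = 0 ∧ v.2.2 = 0

/-- A direction in the `θ₁`-block. -/
def IsTheta1Dir (v : E2) : Prop := v.1 = 0 ∧ v.2.1 = 0

/-- A direction in the spatial `(x,y)`-block. -/
def IsSpatialDir (v : E2) : Prop := v.2 = 0

/-- Symbol-valued symbol of orders `(P,L)` with dominant variable `θ₂`: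
`|∂_{θ₂}^α ∂_{θ₁}^β ∂_{(x,y)}^γ a| ≤ C_{αβγ} (1+θ₁²+θ₂²)^{(P-α)/2} (1+θ₁²)^{(L-β)/2}`. -/
def SVS (P L : ℝ) (a : E2 → ℂ) : Prop :=
  ContDiff ℝ (⊤ : ℕ∞) a ∧
  ∀ α β γ : ℕ, ∃ C : ℝ, ∀ (z : E2) (v : Fin (α + β + γ) → E2),
    (∀ i, ‖v i‖ ≤ 1) →
    (∀ i : Fin (α + β + γ), (i : ℕ) < α → IsTheta2Dir (v i)) →
    (∀ i : Fin (α + β + γ), α ≤ (i : ℕ) → (i : ℕ) < α + β → IsTheta1Dir (v i)) →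
    (∀ i : Fin (α + β + γ), α + β ≤ (i : ℕ) → IsSpatialDir (v i)) →
    ‖iteratedFDeriv ℝ (α + β + γ) a z v‖ ≤
      C * (1 + z.2.2 ^ 2 + z.2.1 ^ 2) ^ ((P - α) / 2) * (1 + z.2.2 ^ 2) ^ ((L - β) / 2)

/-- The ambient space of variables `w = ((x,y),θ₂)` for the partially integrated symbol. -/
abbrev F2 : Type := ((ℝ × ℝ) × (ℝ × ℝ)) × ℝ

/-- A `θ₂`-direction in `F2`. -/
def IsTheta2DirF (v : F2) : Prop := v.1 = 0

/-- A spatial direction in `F2`. -/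
def IsSpatialDirF (v : F2) : Prop := v.2 = 0

/-- `ã` is a symbol of order `M` and type `(1,δ)` in `θ₂`. -/
def SymbolOneDelta (δ M : ℝ) (g : F2 → ℂ) : Prop :=
  ContDiff ℝ (⊤ : ℕ∞) g ∧
  ∀ m γ : ℕ, ∃ C : ℝ, ∀ (w : F2) (v : Fin (m + γ) → F2),
    (∀ i, ‖v i‖ ≤ 1) →
    (∀ i : Fin (m + γ), (i : ℕ) < m → IsTheta2DirF (v i)) →
    (∀ i : Fin (m + γ), m ≤ (i : ℕ) → IsSpatialDirF (v i)) →
    ‖iteratedFDeriv ℝ (m + γ) g w v‖ ≤ C * (1 + w.2 ^ 2) ^ ((M - m + δ * γ) / 2)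

section DirectionalDerivatives

variable {E : Type*} [NormedAddCommGroup E] [NormedSpace ℝ E]

/-- Iterated directional derivative along a list of directions; the head is applied last. -/
def iteratedDirDeriv (l : List E) (f : E → ℂ) : E → ℂ :=
  l.foldr (fun v g z => fderiv ℝ g z v) f

@[simp] lemma iteratedDirDeriv_nil (f : E → ℂ) : iteratedDirDeriv [] f = f := rfl

@[simp] lemma iteratedDirDeriv_cons (v : E) (l : List E) (f : E → ℂ) :
    iteratedDirDeriv (v :: l) f = fun z => fderiv ℝ (iteratedDirDeriv l f) z v := rfl

lemma iteratedDirDeriv_concat (l : List E) (v : E) (f : E → ℂ) :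
    iteratedDirDeriv (l ++ [v]) f = iteratedDirDeriv l (fun z => fderiv ℝ f z v) := by
  simp [iteratedDirDeriv]

lemma contDiff_fderiv_apply_const {f : E → ℂ} (hf : ContDiff ℝ (⊤ : ℕ∞) f) (v : E) :
    ContDiff ℝ (⊤ : ℕ∞) (fun z => fderiv ℝ f z v) :=
  (hf.fderiv_right (m := (⊤ : ℕ∞)) (by simp)).clm_apply contDiff_const

lemma contDiff_iteratedDirDeriv {f : E → ℂ} (hf : ContDiff ℝ (⊤ : ℕ∞) f) (l : List E) :
    ContDiff ℝ (⊤ : ℕ∞) (iteratedDirDeriv l f) := by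
  induction l with
  | nil => exact hf
  | cons v l ih => exact contDiff_fderiv_apply_const ih v

lemma differentiable_iteratedDirDeriv {f : E → ℂ} (hf : ContDiff ℝ (⊤ : ℕ∞) f) (l : List E) :
    Differentiable ℝ (iteratedDirDeriv l f) :=
  (contDiff_iteratedDirDeriv hf l).differentiable (by simp)

lemma iteratedDirDeriv_ofFn {f : E → ℂ} (hf : ContDiff ℝ (⊤ : ℕ∞) f) {n : ℕ} (v : Fin n → E)
    (z : E) : iteratedDirDeriv (List.ofFn v) f z = iteratedFDeriv ℝ n f z v := by
  induction n generalizing z with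
  | zero => simp
  | succ n ih =>
    have hd : Differentiable ℝ (iteratedFDeriv ℝ n f) :=
      hf.differentiable_iteratedFDeriv (by exact_mod_cast ENat.natCast_lt_top n)
    rw [List.ofFn_succ, iteratedDirDeriv_cons, iteratedFDeriv_succ_apply_left,
      ← fderiv_continuousMultilinear_apply_const_apply (hd z)]
    have h : iteratedDirDeriv (List.ofFn fun i => v i.succ) f =
        fun y => iteratedFDeriv ℝ n f y (Fin.tail v) := funext fun y => ih _ y
    simp only [h]

lemma iteratedDirDeriv_add {f g : E → ℂ} (hf : ContDiff ℝ (⊤ : ℕ∞) f)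
    (hg : ContDiff ℝ (⊤ : ℕ∞) g) (l : List E) :
    iteratedDirDeriv l (fun z => f z + g z) =
      fun z => iteratedDirDeriv l f z + iteratedDirDeriv l g z := by
  induction l with
  | nil => rfl
  | cons v l ih =>
    funext z
    simp only [iteratedDirDeriv_cons, ih]
    rw [fderiv_fun_add (differentiable_iteratedDirDeriv hf l z)
      (differentiable_iteratedDirDeriv hg l z)]
    rfl

/-- A factor that is constant along all the directions can be pulled out. -/
lemma iteratedDirDeriv_mul_of_fderiv_eq_zero {χ f : E → ℂ} (hχ : Differentiable ℝ χ)
    (hf : ContDiff ℝ (⊤ : ℕ∞) f) (l : List E) (hl : ∀ v ∈ l, ∀ z, fderiv ℝ χ z v = 0) :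
    iteratedDirDeriv l (fun z => χ z * f z) = fun z => χ z * iteratedDirDeriv l f z := by
  induction l with
  | nil => rfl
  | cons v l ih =>
    funext z
    simp only [iteratedDirDeriv_cons, ih fun u hu => hl u (List.mem_cons_of_mem _ hu)]
    rw [fderiv_fun_mul (hχ z) (differentiable_iteratedDirDeriv hf l z)]
    simp [hl v List.mem_cons_self z]

end DirectionalDerivatives

section ParametricIntegral

variable {V E G : Type*} [NormedAddCommGroup V] [NormedSpace ℝ V]
  [NormedAddCommGroup E] [NormedSpace ℝ E] [NormedAddCommGroup G] [NormedSpace ℝ G]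

lemma iteratedFDeriv_comp_clm_add {F : E → G} (hF : ContDiff ℝ (⊤ : ℕ∞) F) (ι : V →L[ℝ] E)
    (c : E) (n : ℕ) (w : V) :
    iteratedFDeriv ℝ n (fun w => F (ι w + c)) w =
      (iteratedFDeriv ℝ n F (ι w + c)).compContinuousLinearMap fun _ => ι := by
  have h := ι.iteratedFDeriv_comp_right (f := fun z => F (z + c)) (n := (⊤ : ℕ∞))
    (hF.comp (contDiff_id.add contDiff_const)) w (i := n) (by exact_mod_cast le_top)
  rw [iteratedFDeriv_comp_add_right] at h
  exact h

variable [ProperSpace V] [CompleteSpace G]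

/-- Differentiation under the integral sign, to all orders, for an integrand whose support in the
integration variable is locally bounded. -/
theorem hasFTaylorSeriesUpTo_integral_line {F : E → G} (hF : ContDiff ℝ (⊤ : ℕ∞) F)
    (ι : V →L[ℝ] E) (e : E) {R : V → ℝ} (hR : Continuous R)
    (hsupp : ∀ (n : ℕ) (w : V) (t : ℝ), R w < |t| → iteratedFDeriv ℝ n F (ι w + t • e) = 0) :
    (∀ (n : ℕ) (w : V), Integrable fun t : ℝ =>
      iteratedFDeriv ℝ n (fun w => F (ι w + t • e)) w) ∧
    HasFTaylorSeriesUpTo (⊤ : ℕ∞) (fun w => ∫ t : ℝ, F (ι w + t • e))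
      (fun w n => ∫ t : ℝ, iteratedFDeriv ℝ n (fun w => F (ι w + t • e)) w) := by
  have hcont : ∀ n : ℕ, Continuous fun p : V × ℝ =>
      iteratedFDeriv ℝ n (fun w => F (ι w + p.2 • e)) p.1 := by
    intro n
    simp_rw [iteratedFDeriv_comp_clm_add hF]
    have h1 : Continuous (iteratedFDeriv ℝ n F) :=
      hF.continuous_iteratedFDeriv (by exact_mod_cast le_top)
    exact (ContinuousMultilinearMap.compContinuousLinearMapL (fun _ : Fin n => ι)).continuous.comp
      (h1.comp (by fun_prop))
  have hzero : ∀ (n : ℕ) (w : V) (t : ℝ), R w < |t| →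
      iteratedFDeriv ℝ n (fun w => F (ι w + t • e)) w = 0 := by
    intro n w t h
    rw [iteratedFDeriv_comp_clm_add hF, hsupp n w t h]
    ext; simp
  have hcont' : ∀ (n : ℕ) (w : V), Continuous fun t : ℝ =>
      iteratedFDeriv ℝ n (fun w => F (ι w + t • e)) w :=
    fun n w => (hcont n).comp (Continuous.prodMk_right w)
  have hint : ∀ (n : ℕ) (w : V), Integrable fun t : ℝ =>
      iteratedFDeriv ℝ n (fun w => F (ι w + t • e)) w := by
    intro n w
    refine (hcont' n w).integrable_of_hasCompactSupport
      (HasCompactSupport.intro (isCompact_Icc (a := -R w) (b := R w)) fun t ht => hzero n w t ?_)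
    by_contra! h
    exact ht (abs_le.1 h)
  refine ⟨hint, (hasFTaylorSeriesUpTo_top_iff' le_rfl).2 ⟨fun w => ?_, fun n w => ?_⟩⟩
  · rw [ContinuousMultilinearMap.curry0, ContinuousMultilinearMap.integral_apply (hint 0 w)]
    simp
  · obtain ⟨S, hS⟩ := (isCompact_closedBall w 1).exists_bound_of_continuousOn hR.continuousOn
    obtain ⟨C, hC⟩ := ((isCompact_closedBall w 1).prod (isCompact_Icc (a := -S) (b := S))
      ).exists_bound_of_continuousOn (hcont (n + 1)).continuousOn
    let Φ := (continuousMultilinearCurryLeftEquiv ℝ (fun _ : Fin (n + 1) => V) G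
      ).toContinuousLinearEquiv.toContinuousLinearMap
    have hcurry : (∫ t : ℝ, iteratedFDeriv ℝ (n + 1) (fun w => F (ι w + t • e)) w).curryLeft =
        ∫ t : ℝ, (iteratedFDeriv ℝ (n + 1) (fun w => F (ι w + t • e)) w).curryLeft := by
      exact (ContinuousLinearMap.integral_comp_comm (𝕜 := ℝ)
        (Fₗ := V →L[ℝ] V [×n]→L[ℝ] G) Φ (hint (n + 1) w)).symm
    have hmeas : AEStronglyMeasurable (fun t : ℝ =>
        (iteratedFDeriv ℝ (n + 1) (fun w => F (ι w + t • e)) w).curryLeft) volume :=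
      (Φ.continuous.comp (hcont' (n + 1) w)).aestronglyMeasurable
    rw [hcurry]
    refine hasFDerivAt_integral_of_dominated_of_fderiv_le (s := Metric.closedBall w 1)
      (F' := fun x t => (iteratedFDeriv ℝ (n + 1) (fun w => F (ι w + t • e)) x).curryLeft)
      (bound := (Set.Icc (-S) S).indicator fun _ => C)
      (Metric.closedBall_mem_nhds w one_pos)
      (Eventually.of_forall fun x => (hcont' n x).aestronglyMeasurable) (hint n w)
      hmeas
      (Eventually.of_forall fun t x hx => ?_)
      ((integrable_indicator_iff measurableSet_Icc).2 (by simp))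
      (Eventually.of_forall fun t x _ => ?_)
    · rw [ContinuousMultilinearMap.curryLeft_norm]
      by_cases ht : t ∈ Set.Icc (-S) S
      · rw [Set.indicator_of_mem ht]
        exact hC (x, t) ⟨hx, ht⟩
      · rw [Set.indicator_of_notMem ht, hzero, norm_zero]
        have h1 := (le_abs_self _).trans (hS x hx)
        by_contra! h
        exact ht (abs_le.1 (h.trans h1))
    · have hs : ContDiff ℝ (⊤ : ℕ∞) fun w => F (ι w + t • e) :=
        hF.comp (ι.contDiff.add contDiff_const)
      exact ((hasFTaylorSeriesUpTo_top_iff' le_rfl).1 (contDiff_iff_ftaylorSeries.1 hs)).2 n x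

end ParametricIntegral

section Oscillation

/-- The oscillating factor `exp (i (x₁ - y₁) θ₁)` as a function on `E2`. -/
def osc (z : E2) : ℂ := Complex.exp (Complex.I * ((z.1.1.1 - z.1.2.1) * z.2.2 : ℝ))

lemma norm_osc (z : E2) : ‖osc z‖ = 1 := by
  rw [osc, mul_comm, Complex.norm_exp_ofReal_mul_I]

lemma contDiff_osc : ContDiff ℝ (⊤ : ℕ∞) osc := by
  unfold osc
  exact ContDiff.cexp (contDiff_const.mul (Complex.ofRealCLM.contDiff.comp
    (ContDiff.mul (by fun_prop) (by fun_prop))))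

lemma fderiv_osc_apply (z v : E2) (hv : v.2.2 = 0) :
    fderiv ℝ osc z v = osc z * (Complex.I * ((v.1.1.1 - v.1.2.1) * z.2.2 : ℝ)) := by
  have hline : HasDerivAt (fun t : ℝ => osc (z + t • v))
      (osc z * (Complex.I * ((v.1.1.1 - v.1.2.1) * z.2.2 : ℝ))) 0 := by
    have h1 : HasDerivAt (fun t : ℝ => (z.1.1.1 - z.1.2.1 + t * (v.1.1.1 - v.1.2.1)) * z.2.2)
        ((v.1.1.1 - v.1.2.1) * z.2.2) 0 := by
      simpa using (((hasDerivAt_id (0 : ℝ)).mul_const (v.1.1.1 - v.1.2.1)).const_add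
        (z.1.1.1 - z.1.2.1)).mul_const z.2.2
    convert (h1.ofReal_comp.const_mul Complex.I).cexp using 1
    · funext t
      simp only [osc, Prod.fst_add, Prod.snd_add, Prod.smul_fst, Prod.smul_snd, hv, smul_eq_mul]
      congr 3
      ring
    · simp [osc]
  have h2 := (contDiff_osc.differentiable (by simp) z).lineDeriv_eq_fderiv (v := v)
  rw [← h2]
  exact HasLineDerivAt.lineDeriv hline

/-- Derivatives of `osc * b`, first in spatial directions and then in `θ₂`-directions, are
controlled by those of `b`, each spatial derivative costing at most a factor `1 + 2 |θ₁|`. -/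
lemma norm_iteratedDirDeriv_osc_mul_le (z : E2) (l₁ : List E2) (h₁ : ∀ v ∈ l₁, IsTheta2Dir v)
    (l₂ : List E2) (h₂ : ∀ v ∈ l₂, IsSpatialDir v ∧ ‖v‖ ≤ 1) {b : E2 → ℂ}
    (hb : ContDiff ℝ (⊤ : ℕ∞) b) {K : ℝ}
    (hK : ∀ s : List E2, s.length ≤ l₂.length → (∀ v ∈ s, IsSpatialDir v ∧ ‖v‖ ≤ 1) →
      ‖iteratedDirDeriv (l₁ ++ s) b z‖ ≤ K) :
    ‖iteratedDirDeriv (l₁ ++ l₂) (fun z => osc z * b z) z‖ ≤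
      K * (1 + 2 * |z.2.2|) ^ l₂.length := by
  induction l₂ using List.reverseRecOn generalizing b K with
  | nil =>
    rw [List.append_nil, iteratedDirDeriv_mul_of_fderiv_eq_zero
      (contDiff_osc.differentiable (by simp)) hb l₁ fun v hv y => by
        rw [fderiv_osc_apply y v (h₁ v hv).2]; simp [(h₁ v hv).1]]
    simpa [norm_osc] using hK [] le_rfl (by simp)
  | append_singleton l v ih =>
    have hv := h₂ v (by simp)
    have hl : ∀ u ∈ l, IsSpatialDir u ∧ ‖u‖ ≤ 1 := fun u hu => h₂ u (by simp [hu])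
    have hv2 : v.2.2 = 0 := by rw [show v.2 = 0 from hv.1]; rfl
    set χ : E2 → ℂ := fun y => Complex.I * ((v.1.1.1 - v.1.2.1) * y.2.2 : ℝ) with hχ
    have hχs : ContDiff ℝ (⊤ : ℕ∞) χ :=
      contDiff_const.mul (Complex.ofRealCLM.contDiff.comp (contDiff_const.mul (by fun_prop)))
    have hχ0 : ∀ u : E2, u.2.2 = 0 → ∀ y, fderiv ℝ χ y u = 0 := by
      intro u hu y
      rw [← (hχs.differentiable (by simp) y).lineDeriv_eq_fderiv]
      simp [lineDeriv, hχ, hu]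
    have hstep : (fun y => fderiv ℝ (fun y => osc y * b y) y v) =
        fun y => osc y * (fderiv ℝ b y v + χ y * b y) := by
      funext y
      rw [fderiv_fun_mul (contDiff_osc.differentiable (by simp) y)
        (hb.differentiable (by simp) y)]
      simp only [add_apply, smul_apply, smul_eq_mul,
        fderiv_osc_apply y v hv2, hχ]
      ring
    have hχz : ‖χ z‖ ≤ 2 * |z.2.2| := by
      have e1 : |v.1.1.1| ≤ 1 := (norm_fst_le v.1.1).trans ((norm_fst_le v.1).trans
        ((norm_fst_le v).trans hv.2))
      have e2 : |v.1.2.1| ≤ 1 := (norm_fst_le v.1.2).trans ((norm_snd_le v.1).trans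
        ((norm_fst_le v).trans hv.2))
      have e3 : |v.1.1.1 - v.1.2.1| ≤ 2 := (abs_sub _ _).trans (by linarith)
      rw [hχ, norm_mul, Complex.norm_I, one_mul, Complex.norm_real, Real.norm_eq_abs, abs_mul]
      gcongr
    rw [← List.append_assoc, iteratedDirDeriv_concat, hstep, List.length_append,
      List.length_singleton, pow_succ', ← mul_assoc]
    refine ih hl ((contDiff_fderiv_apply_const hb v).add (hχs.mul hb)) fun s hs hs' => ?_
    rw [iteratedDirDeriv_add (contDiff_fderiv_apply_const hb v) (hχs.mul hb),
      ← iteratedDirDeriv_concat, List.append_assoc,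
      iteratedDirDeriv_mul_of_fderiv_eq_zero (hχs.differentiable (by simp)) hb]
    · have a1 := hK (s ++ [v]) (by simpa using hs) (by
        intro u hu
        rcases List.mem_append.1 hu with hu | hu
        · exact hs' u hu
        · rw [List.mem_singleton.1 hu]; exact hv)
      have a2 := hK s (hs.trans (by simp)) hs'
      refine (norm_add_le _ _).trans ?_
      rw [norm_mul]
      nlinarith [mul_le_mul hχz a2 (norm_nonneg _) (by positivity)]
    · intro u hu
      rcases List.mem_append.1 hu with hu | hu
      · exact hχ0 u (h₁ u hu).2
      · exact hχ0 u (by rw [show u.2 = 0 from (hs' u hu).1]; rfl)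

end Oscillation

section Estimates

lemma SVS.norm_iteratedDirDeriv_le {P L : ℝ} {a : E2 → ℂ} (ha : SVS P L a) (m k : ℕ) :
    ∃ C : ℝ, ∀ (z : E2) (l₁ l₂ : List E2), l₁.length = m → l₂.length = k →
      (∀ v ∈ l₁, IsTheta2Dir v ∧ ‖v‖ ≤ 1) → (∀ v ∈ l₂, IsSpatialDir v ∧ ‖v‖ ≤ 1) →
      ‖iteratedDirDeriv (l₁ ++ l₂) a z‖ ≤
        C * (1 + z.2.2 ^ 2 + z.2.1 ^ 2) ^ ((P - m) / 2) * (1 + z.2.2 ^ 2) ^ (L / 2) := by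
  obtain ⟨C, hC⟩ := ha.2 m 0 k
  refine ⟨C, fun z l₁ l₂ hl₁ hl₂ h₁ h₂ => ?_⟩
  have hlen : (l₁ ++ l₂).length = m + 0 + k := by simp [hl₁, hl₂]
  have hof : List.ofFn (fun i : Fin (m + 0 + k) => (l₁ ++ l₂)[(i : ℕ)]'(by omega)) =
      l₁ ++ l₂ := List.ext_getElem (by simp [hlen]) (by simp)
  rw [← hof, iteratedDirDeriv_ofFn ha.1]
  have key := hC z (fun i : Fin (m + 0 + k) => (l₁ ++ l₂)[(i : ℕ)]'(by omega)) ?_ ?_ ?_ ?_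
  · simpa using key
  · intro i
    rcases List.mem_append.1 (List.getElem_mem (l := l₁ ++ l₂) (n := i) (by omega)) with h | h
    · exact (h₁ _ h).2
    · exact (h₂ _ h).2
  · intro i hi
    rw [List.getElem_append_left (by omega)]
    exact (h₁ _ (List.getElem_mem _)).1
  · intro i hi hi'
    omega
  · intro i hi
    rw [List.getElem_append_right (by omega)]
    exact (h₂ _ (List.getElem_mem _)).1

/-- Raising the order in the subordinate variable. -/
lemma SVS.mono_right {P L L' : ℝ} (hL : L ≤ L') {a : E2 → ℂ} (ha : SVS P L a) : SVS P L' a := by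
  refine ⟨ha.1, fun α β γ => ?_⟩
  obtain ⟨C, hC⟩ := ha.2 α β γ
  refine ⟨|C|, fun z v h1 h2 h3 h4 => (hC z v h1 h2 h3 h4).trans ?_⟩
  have hb : 1 ≤ 1 + z.2.2 ^ 2 := by nlinarith [sq_nonneg z.2.2]
  have hA : 0 ≤ (1 + z.2.2 ^ 2 + z.2.1 ^ 2) ^ ((P - α) / 2) := by positivity
  have hp : (1 + z.2.2 ^ 2) ^ ((L - β) / 2) ≤ (1 + z.2.2 ^ 2) ^ ((L' - β) / 2) :=
    rpow_le_rpow_of_exponent_le hb (by linarith)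
  gcongr
  exact le_abs_self C

lemma rpow_le_const_mul_rpow {A x y q : ℝ} (hx : 0 < x) (hxy : x ≤ y) (hA : 1 ≤ A)
    (hyA : y ≤ A * x) : y ^ q ≤ A ^ |q| * x ^ q := by
  rcases le_total 0 q with hq | hq
  · rw [abs_of_nonneg hq, ← mul_rpow (by linarith) hx.le]
    exact rpow_le_rpow (by linarith) hyA hq
  · calc y ^ q ≤ 1 * x ^ q := by rw [one_mul]; exact rpow_le_rpow_of_nonpos hx hxy hq
      _ ≤ A ^ |q| * x ^ q := by gcongr; exact one_le_rpow hA (abs_nonneg q)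

/-- The inclusion `((x,y),θ₂) ↦ ((x,y),(θ₂,0))`. -/
def inclF : F2 →L[ℝ] E2 :=
  (ContinuousLinearMap.fst ℝ _ ℝ).prod ((ContinuousLinearMap.snd ℝ _ ℝ).prod 0)

lemma inclF_apply (w : F2) : inclF w = (w.1, (w.2, 0)) := rfl

lemma inclF_add_smul (w : F2) (t : ℝ) :
    inclF w + t • ((0, (0, 1)) : E2) = (w.1, (w.2, t)) := by
  simp [inclF_apply]

lemma norm_inclF_le (w : F2) : ‖inclF w‖ ≤ ‖w‖ := by
  simp [inclF_apply, Prod.norm_def]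

lemma sqrt_le_of_iteratedFDeriv_ne_zero {δ C₀ : ℝ} {a : E2 → ℂ}
    (hsupp : ∀ z : E2, a z ≠ 0 → √(1 + z.2.2 ^ 2) ≤ C₀ * (1 + z.2.1 ^ 2) ^ (δ / 2))
    {n : ℕ} {z : E2} (hz : iteratedFDeriv ℝ n (fun z => osc z * a z) z ≠ 0) :
    √(1 + z.2.2 ^ 2) ≤ C₀ * (1 + z.2.1 ^ 2) ^ (δ / 2) := by
  have hcl : IsClosed {z : E2 | √(1 + z.2.2 ^ 2) ≤ C₀ * (1 + z.2.1 ^ 2) ^ (δ / 2)} := by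
    refine isClosed_le (by fun_prop) (continuous_const.mul ?_)
    exact Continuous.rpow_const (by fun_prop) fun z => Or.inl (by positivity)
  exact closure_minimal (fun y hy => hsupp y (right_ne_zero_of_mul hy)) hcl
    (support_iteratedFDeriv_subset n hz)

lemma norm_iteratedFDeriv_osc_mul_le {P L δ C₀ : ℝ} (hδ1 : δ ≤ 1) (hC₀ : 1 ≤ C₀) {a : E2 → ℂ}
    (ha : SVS P L a)
    (hsupp : ∀ z : E2, a z ≠ 0 → √(1 + z.2.2 ^ 2) ≤ C₀ * (1 + z.2.1 ^ 2) ^ (δ / 2))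
    (m γ : ℕ) : ∃ K : ℝ, 0 ≤ K ∧ ∀ (w : F2) (t : ℝ) (v : Fin (m + γ) → F2),
      (∀ i, ‖v i‖ ≤ 1) → (∀ i : Fin (m + γ), (i : ℕ) < m → IsTheta2DirF (v i)) →
      (∀ i : Fin (m + γ), m ≤ (i : ℕ) → IsSpatialDirF (v i)) →
      ‖iteratedFDeriv ℝ (m + γ) (fun z => osc z * a z) (w.1, (w.2, t)) (fun i => inclF (v i))‖ ≤
        (Set.Icc (-(C₀ * (1 + w.2 ^ 2) ^ (δ / 2))) (C₀ * (1 + w.2 ^ 2) ^ (δ / 2))).indicator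
          (fun t => K * (1 + w.2 ^ 2) ^ ((P - m + δ * γ) / 2) * (1 + t ^ 2) ^ (L / 2)) t := by
  choose C hC using fun k => ha.norm_iteratedDirDeriv_le m k
  set S := ∑ k ∈ Finset.range (γ + 1), |C k| with hS
  have hS0 : 0 ≤ S := Finset.sum_nonneg fun _ _ => abs_nonneg _
  refine ⟨S * (1 + C₀ ^ 2) ^ |(P - m) / 2| * (3 * C₀) ^ γ, by positivity,
    fun w t v hv hv₁ hv₂ => ?_⟩
  set Q := 1 + w.2 ^ 2 with hQ
  have hQ1 : 1 ≤ Q := by nlinarith [sq_nonneg w.2]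
  set z : E2 := (w.1, (w.2, t)) with hz
  by_cases h0 : iteratedFDeriv ℝ (m + γ) (fun z => osc z * a z) z = 0
  · rw [h0]
    simp only [zero_apply, norm_zero]
    exact Set.indicator_nonneg (fun t _ => by positivity) t
  have hs : √(1 + t ^ 2) ≤ C₀ * Q ^ (δ / 2) := sqrt_le_of_iteratedFDeriv_ne_zero hsupp h0
  have habs : |t| ≤ √(1 + t ^ 2) := abs_le_sqrt (by linarith)
  rw [Set.indicator_of_mem (Set.mem_Icc.2 (abs_le.1 (habs.trans hs)))]
  have hF : ContDiff ℝ (⊤ : ℕ∞) fun z => osc z * a z := contDiff_osc.mul ha.1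
  have hsplit : List.ofFn (fun i => inclF (v i)) =
      List.ofFn (fun i : Fin m => inclF (v (Fin.castAdd γ i))) ++
        List.ofFn (fun i : Fin γ => inclF (v (Fin.natAdd m i))) := by
    rw [← List.ofFn_fin_append]
    congr 1
    funext i
    refine Fin.addCases (fun i => ?_) (fun i => ?_) i <;> simp
  have hl₁ : ∀ u ∈ List.ofFn (fun i : Fin m => inclF (v (Fin.castAdd γ i))),
      IsTheta2Dir u ∧ ‖u‖ ≤ 1 := by
    intro u hu
    obtain ⟨i, rfl⟩ := (List.mem_ofFn' _ _).1 hu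
    exact ⟨⟨hv₁ _ (by simp), rfl⟩, (norm_inclF_le _).trans (hv _)⟩
  have hl₂ : ∀ u ∈ List.ofFn (fun i : Fin γ => inclF (v (Fin.natAdd m i))),
      IsSpatialDir u ∧ ‖u‖ ≤ 1 := by
    intro u hu
    obtain ⟨i, rfl⟩ := (List.mem_ofFn' _ _).1 hu
    refine ⟨?_, (norm_inclF_le _).trans (hv _)⟩
    have : (v (Fin.natAdd m i)).2 = 0 := hv₂ _ (by simp)
    simp [IsSpatialDir, inclF_apply, this]
  set B := (1 + t ^ 2 + w.2 ^ 2) ^ ((P - m) / 2) * (1 + t ^ 2) ^ (L / 2) with hB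
  have hB0 : 0 ≤ B := by positivity
  rw [← iteratedDirDeriv_ofFn hF, hsplit]
  have hbound := norm_iteratedDirDeriv_osc_mul_le z _ (fun u hu => (hl₁ u hu).1) _ hl₂ ha.1
    (K := S * B) fun s hlen hs' => by
      refine (hC s.length z _ s (by simp) rfl hl₁ hs').trans ?_
      rw [mul_assoc]
      refine mul_le_mul_of_nonneg_right ((le_abs_self _).trans ?_) hB0
      exact Finset.single_le_sum (f := fun k => |C k|) (fun _ _ => abs_nonneg _)
        (Finset.mem_range.2 (by simpa [Nat.lt_succ_iff] using hlen))
  refine hbound.trans ?_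
  rw [List.length_ofFn]
  have hsqrt1 : 1 ≤ √(1 + t ^ 2) := one_le_sqrt.2 (by nlinarith [sq_nonneg t])
  have hlin : (1 + 2 * |t|) ^ γ ≤ (3 * C₀) ^ γ * Q ^ (δ * γ / 2) := by
    have e : Q ^ (δ * γ / 2) = (Q ^ (δ / 2)) ^ γ := by
      rw [← rpow_natCast, ← rpow_mul (by linarith)]; ring_nf
    rw [e, ← mul_pow]
    exact pow_le_pow_left₀ (by positivity) (by linarith) γ
  have hcomp : (1 + t ^ 2 + w.2 ^ 2) ^ ((P - m) / 2) ≤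
      (1 + C₀ ^ 2) ^ |(P - m) / 2| * Q ^ ((P - m) / 2) := by
    have hQδ : (Q ^ (δ / 2)) ^ 2 ≤ Q := by
      rw [← rpow_natCast, ← rpow_mul (by linarith)]
      calc Q ^ (δ / 2 * (2 : ℕ)) ≤ Q ^ (1 : ℝ) :=
            rpow_le_rpow_of_exponent_le hQ1 (by push_cast; linarith)
        _ = Q := rpow_one Q
    have h1 : 1 + t ^ 2 ≤ (C₀ * Q ^ (δ / 2)) ^ 2 :=
      (sqrt_le_left (by positivity)).1 hs
    rw [mul_pow] at h1
    refine rpow_le_const_mul_rpow (by linarith) (by rw [hQ]; nlinarith [sq_nonneg t])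
      (by nlinarith [sq_nonneg C₀]) ?_
    nlinarith [mul_le_mul_of_nonneg_left hQδ (sq_nonneg C₀)]
  have hexp : Q ^ ((P - m + δ * γ) / 2) = Q ^ ((P - m) / 2) * Q ^ (δ * γ / 2) := by
    rw [← rpow_add (by linarith)]; ring_nf
  calc S * B * (1 + 2 * |z.2.2|) ^ γ
      ≤ S * (((1 + C₀ ^ 2) ^ |(P - m) / 2| * Q ^ ((P - m) / 2)) * (1 + t ^ 2) ^ (L / 2)) *
        ((3 * C₀) ^ γ * Q ^ (δ * γ / 2)) := by
        rw [hB]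
        gcongr
    _ = _ := by rw [hexp]; ring

/-- Reduction of the symbol estimates to a bound for the integrals of `⟨θ₁⟩ ^ L`. -/
lemma symbolOneDelta_integral {P L δ C₀ N : ℝ} (hδ0 : 0 ≤ δ) (hδ1 : δ ≤ 1) (hC₀ : 1 ≤ C₀)
    {a : E2 → ℂ} (ha : SVS P L a)
    (hsupp : ∀ z : E2, a z ≠ 0 → √(1 + z.2.2 ^ 2) ≤ C₀ * (1 + z.2.1 ^ 2) ^ (δ / 2))
    (hN : ∃ K : ℝ, ∀ R : ℝ, 1 ≤ R → ∫ t in Set.Icc (-R) R, (1 + t ^ 2) ^ (L / 2) ≤ K * R ^ N) :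
    (∀ w : F2, Integrable (fun θ₁ : ℝ =>
      Complex.exp (Complex.I * ((w.1.1.1 - w.1.2.1) * θ₁ : ℝ)) * a (w.1, (w.2, θ₁)))) ∧
    SymbolOneDelta δ (P + δ * N) (fun w : F2 =>
      ∫ θ₁ : ℝ, Complex.exp (Complex.I * ((w.1.1.1 - w.1.2.1) * θ₁ : ℝ)) *
        a (w.1, (w.2, θ₁))) := by
  have hF : ContDiff ℝ (⊤ : ℕ∞) fun z => osc z * a z := contDiff_osc.mul ha.1
  have hRc : Continuous fun w : F2 => C₀ * (1 + w.2 ^ 2) ^ (δ / 2) :=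
    continuous_const.mul (Continuous.rpow_const (by fun_prop) fun w => Or.inl (by positivity))
  obtain ⟨hint, hser⟩ := hasFTaylorSeriesUpTo_integral_line hF inclF (0, (0, 1)) hRc
    fun n w t h => by
      rw [inclF_add_smul]
      by_contra hne
      have h1 : √(1 + t ^ 2) ≤ C₀ * (1 + w.2 ^ 2) ^ (δ / 2) :=
        sqrt_le_of_iteratedFDeriv_ne_zero hsupp hne
      have h2 : |t| ≤ √(1 + t ^ 2) := abs_le_sqrt (by linarith)
      linarith
  have hfun : (fun w : F2 => ∫ t : ℝ, (fun z => osc z * a z) (inclF w + t • (0, (0, 1)))) =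
      fun w : F2 => ∫ θ₁ : ℝ, Complex.exp (Complex.I * ((w.1.1.1 - w.1.2.1) * θ₁ : ℝ)) *
        a (w.1, (w.2, θ₁)) := by
    simp only [inclF_add_smul, osc]
  rw [hfun] at hser
  refine ⟨fun w => ?_, hser.contDiff, fun m γ => ?_⟩
  · have h := (ContinuousMultilinearMap.apply ℝ (fun _ : Fin 0 => F2) ℂ 0).integrable_comp
      (hint 0 w)
    simpa only [ContinuousMultilinearMap.apply_apply, iteratedFDeriv_zero_apply,
      inclF_add_smul, osc] using h
  obtain ⟨K, hK0, hK⟩ := norm_iteratedFDeriv_osc_mul_le hδ1 hC₀ ha hsupp m γ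
  obtain ⟨K', hK'⟩ := hN
  refine ⟨K * (K' * C₀ ^ N), fun w v hv hv₁ hv₂ => ?_⟩
  set Q := 1 + w.2 ^ 2 with hQ
  have hQ1 : 1 ≤ Q := by nlinarith [sq_nonneg w.2]
  set R := C₀ * Q ^ (δ / 2) with hR
  have hR1 : 1 ≤ R := one_le_mul_of_one_le_of_one_le hC₀ (one_le_rpow hQ1 (by linarith))
  rw [← hser.eq_iteratedFDeriv (m := m + γ) (by exact_mod_cast le_top) w,
    ContinuousMultilinearMap.integral_apply (hint _ w)]
  have hcont : Continuous fun t : ℝ => K * Q ^ ((P - m + δ * γ) / 2) * (1 + t ^ 2) ^ (L / 2) :=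
    continuous_const.mul (Continuous.rpow_const (by fun_prop) fun t => Or.inl (by positivity))
  refine (norm_integral_le_of_norm_le
    ((integrable_indicator_iff (measurableSet_Icc (a := -R) (b := R))).2
      (hcont.continuousOn.integrableOn_compact isCompact_Icc))
    (Eventually.of_forall fun t => ?_)).trans ?_
  · rw [iteratedFDeriv_comp_clm_add hF, inclF_add_smul]
    exact hK w t v hv hv₁ hv₂
  · rw [integral_indicator measurableSet_Icc, integral_const_mul]
    calc K * Q ^ ((P - m + δ * γ) / 2) * ∫ t in Set.Icc (-R) R, (1 + t ^ 2) ^ (L / 2)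
        ≤ K * Q ^ ((P - m + δ * γ) / 2) * (K' * R ^ N) := by
          gcongr
          exact hK' R hR1
      _ = K * (K' * C₀ ^ N) * (Q ^ ((P - m + δ * γ) / 2) * Q ^ (δ / 2 * N)) := by
          rw [hR, mul_rpow (by linarith) (by positivity), ← rpow_mul (by linarith)]
          ring
      _ = _ := by
          rw [← rpow_add (by linarith)]
          ring_nf

lemma integral_weight_le_of_neg_one_lt {L : ℝ} (hL : -1 < L) :
    ∃ K : ℝ, ∀ R : ℝ, 1 ≤ R →
      ∫ t in Set.Icc (-R) R, (1 + t ^ 2) ^ (L / 2) ≤ K * R ^ (L + 1) := by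
  obtain ⟨s, hs, hsL, hs0⟩ : ∃ s : ℝ, -1 < s ∧ s ≤ L ∧ s ≤ 0 :=
    ⟨min L 0, by simp [hL], min_le_left _ _, min_le_right _ _⟩
  refine ⟨2 * (2 ^ ((L - s) / 2) / (s + 1)), fun R hR => ?_⟩
  have hcont : Continuous fun t : ℝ => (1 + t ^ 2) ^ (L / 2) :=
    Continuous.rpow_const (by fun_prop) fun t => Or.inl (by positivity)
  have hhalf : ∫ t in (0 : ℝ)..R, (1 + t ^ 2) ^ (L / 2) ≤
      2 ^ ((L - s) / 2) / (s + 1) * R ^ (L + 1) := by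
    have hle : ∫ t in (0 : ℝ)..R, (1 + t ^ 2) ^ (L / 2) ≤
        ∫ t in (0 : ℝ)..R, (2 * R ^ 2) ^ ((L - s) / 2) * t ^ s := by
      refine intervalIntegral.integral_mono_on_of_le_Ioo (by linarith)
        (hcont.intervalIntegrable _ _)
        ((intervalIntegral.intervalIntegrable_rpow' hs).const_mul _) fun t ht => ?_
      have ht0 : 0 < t := ht.1
      have htR : t ^ 2 ≤ R ^ 2 := pow_le_pow_left₀ ht0.le ht.2.le 2
      have hsplit : (1 + t ^ 2) ^ (L / 2) = (1 + t ^ 2) ^ ((L - s) / 2) * (1 + t ^ 2) ^ (s / 2) := by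
        rw [← rpow_add (by positivity)]; ring_nf
      have h1 : (1 + t ^ 2) ^ ((L - s) / 2) ≤ (2 * R ^ 2) ^ ((L - s) / 2) :=
        rpow_le_rpow (by positivity) (by nlinarith) (by linarith)
      have h2 : (1 + t ^ 2) ^ (s / 2) ≤ t ^ s := by
        calc (1 + t ^ 2) ^ (s / 2) ≤ (t ^ 2) ^ (s / 2) :=
              rpow_le_rpow_of_nonpos (by positivity) (by linarith) (by linarith)
          _ = t ^ s := by
              rw [← rpow_natCast, ← rpow_mul ht0.le]; push_cast; ring_nf
      rw [hsplit]
      gcongr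
    refine hle.trans (le_of_eq ?_)
    rw [intervalIntegral.integral_const_mul, integral_rpow (Or.inl hs),
      zero_rpow (by linarith), mul_rpow (by norm_num) (by positivity), ← rpow_natCast,
      ← rpow_mul (by linarith), show L + 1 = (L - s) + (s + 1) by ring,
      rpow_add (by linarith) (L - s)]
    push_cast
    rw [show 2 * ((L - s) / 2) = L - s by ring]
    ring
  have hneg : ∫ t in (-R)..0, (1 + t ^ 2) ^ (L / 2) = ∫ t in (0 : ℝ)..R, (1 + t ^ 2) ^ (L / 2) := by
    have h := intervalIntegral.integral_comp_neg (a := (0 : ℝ)) (b := R)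
      fun t : ℝ => (1 + t ^ 2) ^ (L / 2)
    simpa using h.symm
  rw [integral_Icc_eq_integral_Ioc, ← intervalIntegral.integral_of_le (by linarith),
    ← intervalIntegral.integral_add_adjacent_intervals (b := 0) (hcont.intervalIntegrable _ _)
      (hcont.intervalIntegrable _ _), hneg]
  linarith

lemma integral_weight_le_of_lt_neg_one {L : ℝ} (hL : L < -1) :
    ∃ K : ℝ, ∀ R : ℝ, 1 ≤ R →
      ∫ t in Set.Icc (-R) R, (1 + t ^ 2) ^ (L / 2) ≤ K * R ^ (0 : ℝ) := by
  have hint : Integrable fun t : ℝ => (1 + t ^ 2) ^ (L / 2) := by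
    have h := integrable_rpow_neg_one_add_norm_sq (E := ℝ) (μ := volume) (r := -L)
      (by simp; linarith)
    simpa using h
  refine ⟨∫ t : ℝ, (1 + t ^ 2) ^ (L / 2), fun R _ => ?_⟩
  rw [rpow_zero, mul_one]
  exact setIntegral_le_integral hint (Eventually.of_forall fun t => by positivity)

end Estimates

/-- Integrating out `θ₁` over a region `⟨θ₁⟩ ≤ C₀ ⟨θ₂⟩^δ` (with
`0 < δ < 1/2`) turns a symbol-valued symbol of orders `(P,L)` into a symbol of order
`M` and type `(1,δ)` in `θ₂`, where `M = P + δ(L+1)` for `L > -1`, `M = P` for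
`L < -1`, and `M = P + ε` (any `ε > 0`) for `L = -1`. -/
theorem stmt5 (P L δ C₀ : ℝ) (hδ0 : 0 < δ) (hδ1 : δ < 1/2) (hC₀ : 0 < C₀)
    (a : E2 → ℂ) (ha : SVS P L a)
    (hsupp : ∀ z : E2, a z ≠ 0 →
      Real.sqrt (1 + z.2.2 ^ 2) ≤ C₀ * (1 + z.2.1 ^ 2) ^ (δ / 2)) :
    (∀ w : F2, Integrable (fun θ₁ : ℝ =>
      Complex.exp (Complex.I * ((w.1.1.1 - w.1.2.1) * θ₁ : ℝ)) * a (w.1, (w.2, θ₁)))) ∧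
    (L > -1 → SymbolOneDelta δ (P + δ * (L + 1)) (fun w : F2 =>
      ∫ θ₁ : ℝ, Complex.exp (Complex.I * ((w.1.1.1 - w.1.2.1) * θ₁ : ℝ)) * a (w.1, (w.2, θ₁)))) ∧
    (L < -1 → SymbolOneDelta δ P (fun w : F2 =>
      ∫ θ₁ : ℝ, Complex.exp (Complex.I * ((w.1.1.1 - w.1.2.1) * θ₁ : ℝ)) * a (w.1, (w.2, θ₁)))) ∧
    (L = -1 → ∀ ε : ℝ, 0 < ε → SymbolOneDelta δ (P + ε) (fun w : F2 =>
      ∫ θ₁ : ℝ, Complex.exp (Complex.I * ((w.1.1.1 - w.1.2.1) * θ₁ : ℝ)) * a (w.1, (w.2, θ₁)))) := by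
  have hδ : δ ≤ 1 := by linarith
  have hsupp' : ∀ z : E2, a z ≠ 0 →
      √(1 + z.2.2 ^ 2) ≤ max C₀ 1 * (1 + z.2.1 ^ 2) ^ (δ / 2) := fun z hz =>
    (hsupp z hz).trans (by gcongr; exact le_max_left _ _)
  have main : ∀ L' : ℝ, L ≤ L' → -1 < L' → _ := fun L' h1 h2 =>
    symbolOneDelta_integral hδ0.le hδ (le_max_right C₀ 1) (ha.mono_right h1) hsupp'
      (integral_weight_le_of_neg_one_lt h2)
  refine ⟨(main (max L 0) (le_max_left _ _) (by simp)).1, fun hL => (main L le_rfl hL).2,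
    fun hL => ?_, fun hL ε hε => ?_⟩
  · simpa using (symbolOneDelta_integral hδ0.le hδ (le_max_right C₀ 1) ha hsupp'
      (integral_weight_le_of_lt_neg_one hL)).2
  · have hpos : 0 < ε / δ := by positivity
    have h := (main (-1 + ε / δ) (by linarith) (by linarith)).2
    rwa [show δ * (-1 + ε / δ + 1) = ε by field_simp; ring] at h
end
end
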